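/- non(σC₀) = non(M), where σC₀ is the σ-ideal generated by minimal Cantor sets in the Hilbert cube I^ω and M is the σ-ideal of meager subsets of I^ω. -/

import Mathlib

open Set Topology Cardinal

/-- The Hilbert cube `[0,1]^ℕ` with the product topology. -/
abbrev HilbertCube : Type := ℕ → ↥(Set.Icc (0:ℝ) 1)

/-- An ideal of subsets: a nonempty family closed under subsets and finite unions. -/
def IsIdeal {X : Type*} (I : Set (Set X)) : Prop :=
  I.Nonempty ∧ (∀ A ∈ I, ∀ B, B ⊆ A → B ∈ I) ∧ (∀ A ∈ I, ∀ B ∈ I, A ∪ B ∈ I)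

/-- A σ-ideal: an ideal closed under countable unions. -/
def IsSigmaIdeal {X : Type*} (I : Set (Set X)) : Prop :=
  IsIdeal I ∧ ∀ A : ℕ → Set X, (∀ n, A n ∈ I) → (⋃ n, A n) ∈ I

/-- A non-trivial ideal contains an uncountable set but not the whole space. -/
def NontrivialIdeal {X : Type*} (I : Set (Set X)) : Prop :=
  (∃ A ∈ I, ¬ A.Countable) ∧ Set.univ ∉ I

/-- An ideal on a topological space is topologically invariant if it is preserved by
all homeomorphisms of the space. -/
def TopInvariant {X : Type*} [TopologicalSpace X] (I : Set (Set X)) : Prop :=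
  ∀ h : X ≃ₜ X, {B | ∃ A ∈ I, B = h '' A} = I

/-- `I` has a base all of whose members satisfy `P`. -/
def HasBaseWith {X : Type*} (I : Set (Set X)) (P : Set X → Prop) : Prop :=
  ∃ B ⊆ I, (∀ A ∈ I, ∃ C ∈ B, A ⊆ C) ∧ ∀ C ∈ B, P C

/-- A set has the Baire property if it differs from some open set by a meager set. -/
def HasBaireProperty {X : Type*} [TopologicalSpace X] (A : Set X) : Prop :=
  ∃ U : Set X, IsOpen U ∧ IsMeagre ((A \ U) ∪ (U \ A))

/-- The σ-ideal of meager subsets of a topological space. -/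
def MeagerIdeal (X : Type*) [TopologicalSpace X] : Set (Set X) := {A | IsMeagre A}

/-- The σ-ideal generated by a family `F`: all subsets of countable unions of members
of `F`. -/
def sigmaGenerated {X : Type*} (F : Set (Set X)) : Set (Set X) :=
  {A | ∃ S : ℕ → Set X, (∀ n, S n ∈ F) ∧ A ⊆ ⋃ n, S n}

/-- A Cantor set in the Hilbert cube: a subset homeomorphic to the Cantor cube. -/
def IsCantorSet (C : Set HilbertCube) : Prop := Nonempty (C ≃ₜ (ℕ → Bool))

/-- A minimal Cantor set: one that can be mapped into any other Cantor set by an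
ambient homeomorphism. -/
def IsMinimalCantorSet (A : Set HilbertCube) : Prop :=
  IsCantorSet A ∧ ∀ B : Set HilbertCube, IsCantorSet B →
    ∃ h : HilbertCube ≃ₜ HilbertCube, h '' A ⊆ B

/-- The family of all minimal Cantor sets in the Hilbert cube. -/
def CantorFamily : Set (Set HilbertCube) := {A | IsMinimalCantorSet A}

/-- The σ-ideal generated by minimal Cantor sets. -/
def sigmaC0 : Set (Set HilbertCube) := sigmaGenerated CantorFamily

/-- A minimal dense Gδ-subset of the Hilbert cube. -/
def IsMinimalDenseGdelta (A : Set HilbertCube) : Prop :=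
  IsGδ A ∧ Dense A ∧ ∀ B : Set HilbertCube, IsGδ B → Dense B →
    ∃ h : HilbertCube ≃ₜ HilbertCube, h '' A ⊆ B

/-- The family of all minimal dense Gδ-sets in the Hilbert cube. -/
def GdeltaFamily : Set (Set HilbertCube) := {A | IsMinimalDenseGdelta A}

/-- The σ-ideal generated by minimal dense Gδ-sets. -/
def sigmaG0 : Set (Set HilbertCube) := sigmaGenerated GdeltaFamily

/-- `cov(I)`: the least cardinality of a subfamily of `I` covering the space. -/
noncomputable def covIdeal {X : Type*} (I : Set (Set X)) : Cardinal :=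
  sInf {c | ∃ A : Set (Set X), A ⊆ I ∧ ⋃₀ A = Set.univ ∧ c = #A}

/-- `non(I)`: the least cardinality of a subset of the space not in `I`. -/
noncomputable def nonIdeal {X : Type*} (I : Set (Set X)) : Cardinal :=
  sInf {c | ∃ A : Set X, A ∉ I ∧ c = #A}

/-- `add(I,J)`: the least cardinality of a subfamily of `I` whose union is not in `J`. -/
noncomputable def addIdeal2 {X : Type*} (I J : Set (Set X)) : Cardinal :=
  sInf {c | ∃ A : Set (Set X), A ⊆ I ∧ ⋃₀ A ∉ J ∧ c = #A}

/-- `add(I) = add(I,I)`. -/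
noncomputable def addIdeal {X : Type*} (I : Set (Set X)) : Cardinal := addIdeal2 I I

/-- `cof(I,J)`: the least cardinality of a subfamily of `J` cofinal in `I`. -/
noncomputable def cofIdeal2 {X : Type*} (I J : Set (Set X)) : Cardinal :=
  sInf {c | ∃ A : Set (Set X), A ⊆ J ∧ (∀ B ∈ I, ∃ C ∈ A, B ⊆ C) ∧ c = #A}

/-- `cof(I) = cof(I,I)`. -/
noncomputable def cofIdeal {X : Type*} (I : Set (Set X)) : Cardinal := cofIdeal2 I I

/-- The compact-open topology on the homeomorphism group of a space, induced by the
compact-open topology of the space of continuous self-maps. -/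
noncomputable instance homeoGroupTopology (X : Type*) [TopologicalSpace X] :
    TopologicalSpace (X ≃ₜ X) :=
  TopologicalSpace.induced (fun h : X ≃ₜ X => (⟨h, h.continuous⟩ : C(X, X)))
    ContinuousMap.compactOpen

/-- A Z-set: a closed set `A` such that for every open cover `U` of the space there is a
continuous map into the complement of `A` which is `U`-near to the identity. -/
def IsZSet {X : Type*} [TopologicalSpace X] (A : Set X) : Prop :=
  IsClosed A ∧ ∀ U : Set (Set X), (∀ V ∈ U, IsOpen V) → ⋃₀ U = Set.univ →
    ∃ f : C(X, X), (∀ x, f x ∉ A) ∧ ∀ x : X, ∃ V ∈ U, x ∈ V ∧ f x ∈ V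

/-- A σZ-set: a countable union of Z-sets. -/
def IsSigmaZSet {X : Type*} [TopologicalSpace X] (A : Set X) : Prop :=
  ∃ Z : ℕ → Set X, (∀ n, IsZSet (Z n)) ∧ A = ⋃ n, Z n

/-- The cube `[0,1]^n`. -/
abbrev FinCube (n : ℕ) : Type := Fin n → ↥(Set.Icc (0:ℝ) 1)

/-- A `Z_n`-set in the Hilbert cube: a closed set `A` such that maps avoiding `A` are
dense in the space `C([0,1]^n, I^ω)` with the compact-open topology. -/
def IsZnSet (n : ℕ) (A : Set HilbertCube) : Prop :=
  IsClosed A ∧ Dense {f : C(FinCube n, HilbertCube) | ∀ x, f x ∉ A}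

/-- A `Z_ω`-set in the Hilbert cube: a closed set which is a `Z_n`-set for all `n`. -/
def IsZomegaSet (A : Set HilbertCube) : Prop :=
  IsClosed A ∧ ∀ n : ℕ, IsZnSet n A

/-- Covering dimension of a space is at most `n`: every finite open cover has a finite
open refinement (still a cover) in which no point belongs to more than `n+1` members. -/
def CovDimLE (Y : Type*) [TopologicalSpace Y] (n : ℕ) : Prop :=
  ∀ U : Set (Set Y), U.Finite → (∀ V ∈ U, IsOpen V) → ⋃₀ U = Set.univ →
    ∃ V : Set (Set Y), V.Finite ∧ (∀ W ∈ V, IsOpen W) ∧ ⋃₀ V = Set.univ ∧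
      (∀ W ∈ V, ∃ W' ∈ U, W ⊆ W') ∧
      ∀ y : Y, {W ∈ V | y ∈ W}.ncard ≤ n + 1

/-- A `G_δ`-generated topologically invariant ideal on the Hilbert cube. -/
def GdeltaGenerated (I : Set (Set HilbertCube)) : Prop :=
  HasBaseWith I IsSigmaCompact ∧
  ∃ G : Set HilbertCube, IsGδ G ∧
    (∀ K : Set HilbertCube, K ⊆ G → IsCompact K → K ∈ I) ∧
    ∀ A ∈ I, IsCompact A →
      Dense {h : HilbertCube ≃ₜ HilbertCube | h '' A ⊆ G}

/-- A `G_δ*`-generated ideal: a preimage of a `G_δ`-generated ideal under an embedding. -/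
def GdeltaStarGenerated (I : Set (Set HilbertCube)) : Prop :=
  ∃ I' : Set (Set HilbertCube), GdeltaGenerated I' ∧
    ∃ e : HilbertCube → HilbertCube, IsEmbedding e ∧ I = {S | ∃ A ∈ I', S = e ⁻¹' A}

/-- A `σG_δ*`-generated ideal. -/
def SigmaGdeltaStarGenerated (I : Set (Set HilbertCube)) : Prop :=
  ∃ In : ℕ → Set (Set HilbertCube), (∀ n, GdeltaStarGenerated (In n)) ∧
    (∀ n, In n ⊆ I) ∧
    ∀ A ∈ I, ∃ K : ℕ → Set HilbertCube,
      (∀ n, IsCompact (K n) ∧ K n ∈ In n) ∧ A ⊆ ⋃ n, K n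

/-- A continuous bijection of the Hilbert cube onto itself as a homeomorphism. -/
lemma exists_homeomorph_of_bijective {X : Type*} [TopologicalSpace X] [CompactSpace X] [T2Space X]
    {f : X → X} (hc : Continuous f) (hb : Function.Bijective f) : ∃ h : X ≃ₜ X, ∀ x, h x = f x :=
  ⟨Continuous.homeoOfEquivCompactToT2 (f := Equiv.ofBijective f hb) hc, fun _ => rfl⟩

/-- Denominator of the Möbius map that fixes `0` and `1` and sends `p` to `1/2`. -/
lemma moebius_denom_pos {p y : ℝ} (hp : p ∈ Ioo (0:ℝ) 1) (hy : y ∈ Icc (0:ℝ) 1) :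
    0 < y * (1 - p) + (1 - y) * p := by
  obtain ⟨h0, h1⟩ := hp
  obtain ⟨g0, g1⟩ := hy
  rcases g0.lt_or_eq with g | g
  · have := mul_pos g (sub_pos.2 h1)
    have := mul_nonneg (sub_nonneg.2 g1) h0.le
    linarith
  · subst g; linarith

/-- The Möbius homeomorphism of `[0,1]` that fixes `0` and `1` and sends `p` to `1/2`. -/
noncomputable def moebius (p : Ioo (0:ℝ) 1) (y : Icc (0:ℝ) 1) : Icc (0:ℝ) 1 :=
  ⟨y * (1 - p) / (y * (1 - p) + (1 - y) * p), by
    have hd := moebius_denom_pos p.2 y.2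
    have h1 : 0 ≤ (y:ℝ) * (1 - p) := mul_nonneg y.2.1 (sub_nonneg.2 p.2.2.le)
    have h2 : 0 ≤ (1 - (y:ℝ)) * p := mul_nonneg (sub_nonneg.2 y.2.2) p.2.1.le
    exact ⟨div_nonneg h1 hd.le, (div_le_one hd).2 (by linarith)⟩⟩

lemma continuous_moebius : Continuous (fun q : Ioo (0:ℝ) 1 × Icc (0:ℝ) 1 => moebius q.1 q.2) := by
  refine Continuous.subtype_mk (Continuous.div (by fun_prop) (by fun_prop) ?_) _
  intro q
  exact (moebius_denom_pos q.1.2 q.2.2).ne'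

/-- The reflection of the open unit interval. -/
def reflectIoo (p : Ioo (0:ℝ) 1) : Ioo (0:ℝ) 1 :=
  ⟨1 - p, by constructor <;> linarith [p.2.1, p.2.2]⟩

lemma continuous_reflectIoo : Continuous reflectIoo :=
  Continuous.subtype_mk (by fun_prop) _

lemma reflectIoo_reflectIoo (p : Ioo (0:ℝ) 1) : reflectIoo (reflectIoo p) = p :=
  Subtype.ext (by simp [reflectIoo])

lemma moebius_reflect (p : Ioo (0:ℝ) 1) (y : Icc (0:ℝ) 1) :
    moebius (reflectIoo p) (moebius p y) = y := by
  have hd := moebius_denom_pos p.2 y.2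
  have hq := moebius_denom_pos (reflectIoo p).2 (moebius p y).2
  apply Subtype.ext
  have hs : (moebius p y : ℝ) = y * (1 - p) / (y * (1 - p) + (1 - y) * p) := rfl
  change (moebius p y : ℝ) * (1 - (1 - p)) / ((moebius p y : ℝ) * (1 - (1 - p)) +
    (1 - (moebius p y : ℝ)) * (1 - p)) = y
  change 0 < (moebius p y : ℝ) * (1 - (1 - p)) + (1 - (moebius p y : ℝ)) * (1 - p) at hq
  have hu : (moebius p y : ℝ) * (y * (1 - p) + (1 - y) * p) = y * (1 - p) := by
    rw [hs, div_mul_cancel₀ _ hd.ne']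
  rw [div_eq_iff hq.ne']
  apply mul_right_cancel₀ hd.ne'
  linear_combination ((p:ℝ) - y * p + y * (1 - p)) * hu

lemma moebius_self (p : Ioo (0:ℝ) 1) (y : Icc (0:ℝ) 1) (h : (y:ℝ) = p) :
    (moebius p y : ℝ) = 1 / 2 := by
  have h0 := p.2.1.ne'
  have h1 : (1 - (p:ℝ)) ≠ 0 := by linarith [p.2.2]
  change (y:ℝ) * (1 - p) / (y * (1 - p) + (1 - y) * p) = _
  rw [h]
  field_simp
  ring

/-- A family of fibrewise Möbius maps over the zeroth coordinate. -/
lemma exists_homeomorph_moebius (F : ℕ → Icc (0:ℝ) 1 → Ioo (0:ℝ) 1) (hF : ∀ i, Continuous (F i)) :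
    ∃ h : HilbertCube ≃ₜ HilbertCube, ∀ x, h x 0 = x 0 ∧
      ∀ i, h x (i + 1) = moebius (F i (x 0)) (x (i + 1)) := by
  let G : (ℕ → Icc (0:ℝ) 1 → Ioo (0:ℝ) 1) → HilbertCube → HilbertCube :=
    fun F x n => Nat.casesOn n (x 0) (fun i => moebius (F i (x 0)) (x (i + 1)))
  have hG : ∀ F : ℕ → Icc (0:ℝ) 1 → Ioo (0:ℝ) 1, (∀ i, Continuous (F i)) → Continuous (G F) := by
    intro F hF
    refine continuous_pi fun n => ?_
    cases n with
    | zero => exact continuous_apply 0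
    | succ i =>
      exact continuous_moebius.comp
        (((hF i).comp (continuous_apply 0)).prodMk (continuous_apply (i + 1)))
  refine ⟨⟨⟨G F, G (fun i t => reflectIoo (F i t)), ?_, ?_⟩, hG F hF,
    hG _ fun i => continuous_reflectIoo.comp (hF i)⟩, fun x => ⟨rfl, fun i => rfl⟩⟩
  · intro x
    funext n
    cases n with
    | zero => rfl
    | succ i => exact moebius_reflect _ _
  · intro x
    funext n
    cases n with
    | zero => rfl
    | succ i =>
      have := moebius_reflect (reflectIoo (F i (x 0))) (x (i + 1))
      rwa [reflectIoo_reflectIoo] at this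

/-- The midpoint of the unit interval. -/
noncomputable def midI : Icc (0:ℝ) 1 := ⟨1 / 2, by norm_num, by norm_num⟩

/-- The points of the zeroth coordinate axis through the centre of the Hilbert cube. -/
noncomputable def axisPoint (t : Icc (0:ℝ) 1) : HilbertCube := fun n => if n = 0 then t else midI

/-- Points of the Hilbert cube all of whose coordinates are interior. -/
def PseudoInterior : Set HilbertCube := {x | ∀ i, (x i : ℝ) ∈ Ioo (0:ℝ) 1}

/-- A compact graph over the zeroth coordinate inside the pseudo-interior can be straightened. -/
lemma exists_homeomorph_straighten {K : Set HilbertCube} (hK : IsCompact K)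
    (hinj : InjOn (fun x : HilbertCube => x 0) K) (hint : K ⊆ PseudoInterior) :
    ∃ h : HilbertCube ≃ₜ HilbertCube, ∀ x ∈ K, h x = axisPoint (x 0) := by
  have : CompactSpace K := isCompact_iff_compactSpace.1 hK
  have he : IsClosedEmbedding (fun k : K => (k : HilbertCube) 0) := by
    refine Continuous.isClosedEmbedding ((continuous_apply 0).comp continuous_subtype_val) ?_
    intro a b hab
    exact Subtype.ext (hinj a.2 b.2 hab)
  have hext : ∀ i : ℕ, ∃ g : C(Icc (0:ℝ) 1, ℝ), (∀ y, g y ∈ Ioo (0:ℝ) 1) ∧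
      ∀ k : K, g ((k : HilbertCube) 0) = ((k : HilbertCube) (i + 1) : ℝ) := by
    intro i
    obtain ⟨g, hg, hge⟩ := ContinuousMap.exists_extension_forall_mem_of_isClosedEmbedding
      (⟨fun k : K => ((k : HilbertCube) (i + 1) : ℝ),
        continuous_subtype_val.comp ((continuous_apply (i + 1)).comp continuous_subtype_val)⟩ : C(K, ℝ))
      (t := Ioo (0:ℝ) 1) (fun k => hint k.2 (i + 1)) ⟨1 / 2, by norm_num⟩ he
    exact ⟨g, hg, fun k => congrFun hge k⟩
  choose g hg hgK using hext
  obtain ⟨h, hh⟩ := exists_homeomorph_moebius (fun i t => ⟨g i t, hg i t⟩)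
    (fun i => (g i).continuous.subtype_mk _)
  refine ⟨h, fun x hx => ?_⟩
  funext n
  cases n with
  | zero => exact (hh x).1
  | succ i =>
    rw [(hh x).2 i]
    exact Subtype.ext (moebius_self _ _ (hgK i ⟨x, hx⟩).symm)

/-- Exchange of two coordinates of the Hilbert cube. -/
lemma exists_homeomorph_swap (i j : ℕ) : ∃ h : HilbertCube ≃ₜ HilbertCube,
    ∀ x n, h x n = x (Equiv.swap i j n) := by
  refine ⟨⟨⟨fun x n => x (Equiv.swap i j n), fun x n => x (Equiv.swap i j n), ?_, ?_⟩, ?_, ?_⟩,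
    fun _ _ => rfl⟩
  · intro x; funext n; simp
  · intro x; funext n; simp
  · exact continuous_pi fun n => continuous_apply _
  · exact continuous_pi fun n => continuous_apply _

/-- A compact set is tame if an ambient homeomorphism moves it onto a graph over the zeroth
coordinate that lies in the pseudo-interior. -/
def IsTame (K : Set HilbertCube) : Prop :=
  IsCompact K ∧ ∃ h : HilbertCube ≃ₜ HilbertCube,
    InjOn (fun x : HilbertCube => x 0) (h '' K) ∧ h '' K ⊆ PseudoInterior

lemma IsTame.mono {K L : Set HilbertCube} (hL : IsTame L) (hK : IsCompact K) (hKL : K ⊆ L) :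
    IsTame K := by
  obtain ⟨-, h, h1, h2⟩ := hL
  exact ⟨hK, h, h1.mono (image_mono hKL), (image_mono hKL).trans h2⟩

lemma IsTame.exists_axis {K : Set HilbertCube} (hK : IsTame K) :
    ∃ h : HilbertCube ≃ₜ HilbertCube, ∃ r : HilbertCube → Icc (0:ℝ) 1, ContinuousOn r K ∧
      InjOn r K ∧ ∀ x ∈ K, (r x : ℝ) ∈ Ioo (0:ℝ) 1 ∧ h x = axisPoint (r x) := by
  obtain ⟨hc, h, hi, hp⟩ := hK
  obtain ⟨g, hg⟩ := exists_homeomorph_straighten (hc.image h.continuous) hi hp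
  refine ⟨h.trans g, fun x => h x 0, ?_, ?_, fun x hx => ⟨hp (mem_image_of_mem h hx) 0, ?_⟩⟩
  · exact ((continuous_apply 0).comp h.continuous).continuousOn
  · intro x hx y hy hxy
    exact h.injective (hi (mem_image_of_mem h hx) (mem_image_of_mem h hy) hxy)
  · exact hg _ (mem_image_of_mem h hx)

/-- Continuous injections between tame sets extend to ambient homeomorphisms. -/
lemma IsTame.exists_extension {K L : Set HilbertCube} (hK : IsTame K) (hL : IsTame L)
    {f : HilbertCube → HilbertCube} (hf : ContinuousOn f K) (hfi : InjOn f K)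
    (hm : MapsTo f K L) : ∃ h : HilbertCube ≃ₜ HilbertCube, ∀ x ∈ K, h x = f x := by
  obtain ⟨h, r, hrc, hri, hr⟩ := hK.exists_axis
  obtain ⟨g, s, hsc, hsi, hs⟩ := hL.exists_axis
  let P : HilbertCube → HilbertCube := fun x n =>
    if n = 0 then r x else if n = 1 then s (f x) else midI
  let Q : HilbertCube → HilbertCube := fun x n =>
    if n = 0 then s (f x) else if n = 1 then r x else midI
  have hsf : ContinuousOn (fun x => s (f x)) K := hsc.comp hf hm
  have hPc : ContinuousOn P K := by
    refine continuousOn_pi.2 fun n => ?_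
    by_cases h0 : n = 0
    · simpa [P, h0] using hrc
    · by_cases h1 : n = 1
      · simpa [P, h1] using hsf
      · simpa [P, h0, h1] using continuousOn_const
  have hQc : ContinuousOn Q K := by
    refine continuousOn_pi.2 fun n => ?_
    by_cases h0 : n = 0
    · simpa [Q, h0] using hsf
    · by_cases h1 : n = 1
      · simpa [Q, h1] using hrc
      · simpa [Q, h0, h1] using continuousOn_const
  have hmid : (midI : ℝ) ∈ Ioo (0:ℝ) 1 := by norm_num [midI]
  obtain ⟨a, ha⟩ := exists_homeomorph_straighten (K := P '' K)
    (hK.1.image_of_continuousOn hPc) (by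
      rintro _ ⟨x, hx, rfl⟩ _ ⟨y, hy, rfl⟩ hxy
      rw [hri hx hy (by simpa [P] using hxy)]) (by
      rintro _ ⟨x, hx, rfl⟩ n
      by_cases h0 : n = 0
      · simpa [P, h0] using (hr x hx).1
      · by_cases h1 : n = 1
        · simpa [P, h1] using (hs _ (hm hx)).1
        · simpa [P, h0, h1] using hmid)
  obtain ⟨b, hb⟩ := exists_homeomorph_straighten (K := Q '' K)
    (hK.1.image_of_continuousOn hQc) (by
      rintro _ ⟨x, hx, rfl⟩ _ ⟨y, hy, rfl⟩ hxy
      rw [hfi hx hy (hsi (hm hx) (hm hy) (by simpa [Q] using hxy))]) (by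
      rintro _ ⟨x, hx, rfl⟩ n
      by_cases h0 : n = 0
      · simpa [Q, h0] using (hs _ (hm hx)).1
      · by_cases h1 : n = 1
        · simpa [Q, h1] using (hr x hx).1
        · simpa [Q, h0, h1] using hmid)
  obtain ⟨c, hc⟩ := exists_homeomorph_swap 0 1
  have hcP : ∀ x, c (P x) = Q x := by
    intro x
    funext n
    rw [hc]
    rcases n with _ | _ | n
    · simp [P, Q]
    · simp [P, Q]
    · rw [Equiv.swap_apply_of_ne_of_ne (by omega) (by omega)]
      simp [P, Q]
  refine ⟨((h.trans a.symm).trans c).trans (b.trans g.symm), fun x hx => ?_⟩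
  have h1 : a.symm (h x) = P x := by
    rw [(hr x hx).2, Homeomorph.symm_apply_eq, ha _ (mem_image_of_mem P hx)]
    rfl
  simp only [Homeomorph.trans_apply, h1, hcP]
  rw [hb _ (mem_image_of_mem Q hx), Homeomorph.symm_apply_eq, (hs _ (hm hx)).2]
  rfl

lemma IsTame.of_image {K : Set HilbertCube} (g : HilbertCube ≃ₜ HilbertCube)
    (hK : IsTame (g '' K)) : IsTame K := by
  obtain ⟨hc, h, h1, h2⟩ := hK
  have hKc : IsCompact K := by simpa using hc
  have he : (g.trans h) '' K = h '' (g '' K) := by rw [image_image]; rfl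
  exact ⟨hKc, g.trans h, he ▸ h1, he ▸ h2⟩

/-- Half-width of an octagon at a given height. -/
noncomputable def octWidth (v : ℝ) : ℝ := min 1 (5 / 4 - |v| / 2)

/-- Half-height of an octagon at a given abscissa. -/
noncomputable def octHeight (u : ℝ) : ℝ := min 1 (5 / 2 - 2 * |u|)

lemma octWidth_ge {v : ℝ} (h : |v| ≤ 1) : 3 / 4 ≤ octWidth v :=
  le_min (by norm_num) (by linarith)

lemma octHeight_ge {u : ℝ} (h : |u| ≤ 1) : 1 / 2 ≤ octHeight u :=
  le_min (by norm_num) (by linarith)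

lemma octWidth_le_one (v : ℝ) : octWidth v ≤ 1 := min_le_left _ _

lemma octHeight_le_one (v : ℝ) : octHeight v ≤ 1 := min_le_left _ _

lemma le_octHeight {u v : ℝ} (hv : |v| ≤ 1) (h : |u| ≤ octWidth v) : |v| ≤ octHeight u := by
  have := h.trans (min_le_right _ _)
  exact le_min hv (by linarith)

lemma le_octWidth {u v : ℝ} (hu : |u| ≤ 1) (h : |v| ≤ octHeight u) : |u| ≤ octWidth v := by
  have := h.trans (min_le_right _ _)
  exact le_min hu (by linarith)

lemma abs_octWidth_sub_le (v w : ℝ) : |octWidth v - octWidth w| ≤ |v - w| / 2 := by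
  have h1 := abs_min_sub_min_le_max 1 (5 / 4 - |v| / 2) 1 (5 / 4 - |w| / 2)
  have h2 := abs_abs_sub_abs_le_abs_sub v w
  have h3 : |5 / 4 - |v| / 2 - (5 / 4 - |w| / 2)| ≤ |v - w| / 2 := by
    rw [show 5 / 4 - |v| / 2 - (5 / 4 - |w| / 2) = -((|v| - |w|) / 2) by ring, abs_neg, abs_div,
      abs_two]
    linarith
  refine h1.trans (max_le ?_ h3)
  simp only [sub_self, abs_zero]
  positivity

lemma continuous_octWidth : Continuous octWidth := by unfold octWidth; fun_prop

lemma continuous_octHeight : Continuous octHeight := by unfold octHeight; fun_prop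

/-- The infinite composition of octagonal moves of consecutive coordinates. -/
noncomputable def octPush (u : ℕ → ℝ) : ℕ → ℝ
  | 0 => u 0 * octWidth (u 1)
  | n + 1 => u (n + 1) * octWidth (u (n + 2)) / octHeight (octPush u n)

/-- The denominators in the definition of `octPush`. -/
noncomputable def octScale (y : ℕ → ℝ) : ℕ → ℝ
  | 0 => 1
  | n + 1 => octHeight (y n)

lemma octScale_pos {y : ℕ → ℝ} (hy : ∀ n, |y n| ≤ 1) (n : ℕ) : 0 < octScale y n := by
  cases n with
  | zero => exact one_pos
  | succ n => exact lt_of_lt_of_le (by norm_num) (octHeight_ge (hy n))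

lemma octScale_le_one (y : ℕ → ℝ) (n : ℕ) : octScale y n ≤ 1 := by
  cases n with
  | zero => exact le_rfl
  | succ n => exact octHeight_le_one _

lemma octPush_eq (u : ℕ → ℝ) (n : ℕ) :
    octPush u n = u n * octWidth (u (n + 1)) / octScale (octPush u) n := by
  cases n with
  | zero => simp [octPush, octScale]
  | succ n => simp [octPush, octScale]

lemma abs_octPush_le {u : ℕ → ℝ} (hu : ∀ n, |u n| ≤ 1) (n : ℕ) :
    |octPush u n| ≤ octWidth (u (n + 1)) := by
  have hw : ∀ n, 0 ≤ octWidth (u n) := fun n => by linarith [octWidth_ge (hu n)]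
  induction n with
  | zero =>
    rw [octPush, abs_mul, abs_of_nonneg (hw 1)]
    exact mul_le_of_le_one_left (hw 1) (hu 0)
  | succ n ih =>
    have h1 := le_octHeight (hu (n + 1)) ih
    have h2 := octHeight_ge (ih.trans (octWidth_le_one _))
    have h3 : 0 < octHeight (octPush u n) := by linarith
    rw [octPush, abs_div, abs_mul, abs_of_nonneg (hw _), abs_of_pos h3, div_le_iff₀ h3, mul_comm]
    exact mul_le_mul_of_nonneg_left h1 (hw _)

lemma abs_octPush_le_one {u : ℕ → ℝ} (hu : ∀ n, |u n| ≤ 1) (n : ℕ) : |octPush u n| ≤ 1 :=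
  (abs_octPush_le hu n).trans (octWidth_le_one _)

lemma octPush_injOn {u v : ℕ → ℝ} (hu : ∀ n, |u n| ≤ 1) (hv : ∀ n, |v n| ≤ 1)
    (h : octPush u = octPush v) : u = v := by
  have hmul : ∀ n, u n * octWidth (u (n + 1)) = v n * octWidth (v (n + 1)) := by
    intro n
    have h1 := octPush_eq u n
    have h2 := octPush_eq v n
    rw [h, h2] at h1
    exact ((div_left_inj' (octScale_pos (abs_octPush_le_one hv) n).ne').1 h1).symm
  have hstep : ∀ n, |u n - v n| ≤ 2 / 3 * |u (n + 1) - v (n + 1)| := by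
    intro n
    have h1 : (u n - v n) * octWidth (u (n + 1)) =
        v n * (octWidth (v (n + 1)) - octWidth (u (n + 1))) := by
      linear_combination hmul n
    have h2 := octWidth_ge (hu (n + 1))
    have h3 := congrArg abs h1
    rw [abs_mul, abs_mul, abs_of_nonneg (by linarith : 0 ≤ octWidth (u (n + 1)))] at h3
    have h4 := abs_octWidth_sub_le (v (n + 1)) (u (n + 1))
    rw [abs_sub_comm (v (n + 1))] at h4
    have h5 : |v n| * |octWidth (v (n + 1)) - octWidth (u (n + 1))| ≤
        |u (n + 1) - v (n + 1)| / 2 :=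
      (mul_le_of_le_one_left (abs_nonneg _) (hv n)).trans h4
    have h6 := mul_le_mul_of_nonneg_left h2 (abs_nonneg (u n - v n))
    linarith
  have hpow : ∀ k n, |u n - v n| ≤ (2 / 3) ^ k * 2 := by
    intro k
    induction k with
    | zero =>
      intro n
      have := abs_sub (u n) (v n)
      have := hu n
      have := hv n
      linarith
    | succ k ih =>
      intro n
      have := hstep n
      have := ih (n + 1)
      rw [pow_succ]
      linarith
  funext n
  have hlim : Filter.Tendsto (fun k : ℕ => (2 / 3 : ℝ) ^ k * 2) Filter.atTop (𝓝 (0 * 2)) :=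
    (tendsto_pow_atTop_nhds_zero_of_lt_one (by norm_num) (by norm_num)).mul_const 2
  have := ge_of_tendsto' hlim (fun k => hpow k n)
  rw [zero_mul] at this
  exact sub_eq_zero.1 (abs_nonpos_iff.1 this)

lemma exists_octPush_eq {y : ℕ → ℝ} (hy : ∀ n, |y n| ≤ 1) (k : ℕ) :
    ∃ u : ℕ → ℝ, (∀ n, |u n| ≤ 1) ∧ ∀ n < k, octPush u n = y n := by
  have key : ∀ k n, ∃ u : ℕ → ℝ, (∀ m, |u m| ≤ octScale y m) ∧
      ∀ m, n ≤ m → m < n + k → u m * octWidth (u (m + 1)) = y m * octScale y m := by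
    intro k
    induction k with
    | zero =>
      intro n
      exact ⟨fun _ => 0, fun m => by simpa using (octScale_pos hy m).le, fun m h1 h2 => by omega⟩
    | succ k ih =>
      intro n
      obtain ⟨u, hu, h⟩ := ih (n + 1)
      have hu1 : |y n| ≤ octWidth (u (n + 1)) := le_octWidth (hy n) (hu (n + 1))
      have hw := octWidth_ge ((hu (n + 1)).trans (octScale_le_one _ _))
      have hw0 : 0 < octWidth (u (n + 1)) := by linarith
      have hs := octScale_pos hy n
      refine ⟨Function.update u n (y n * octScale y n / octWidth (u (n + 1))), fun m => ?_,
        fun m h1 h2 => ?_⟩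
      · by_cases hm : m = n
        · subst hm
          rw [Function.update_self, abs_div, abs_mul, abs_of_pos hs, abs_of_pos hw0,
            div_le_iff₀ hw0, mul_comm]
          exact mul_le_mul_of_nonneg_left hu1 hs.le
        · rw [Function.update_of_ne hm]
          exact hu m
      · rw [Function.update_of_ne (by omega : m + 1 ≠ n)]
        by_cases hm : m = n
        · subst hm
          rw [Function.update_self, div_mul_cancel₀ _ hw0.ne']
        · rw [Function.update_of_ne hm]
          exact h m (by omega) (by omega)
  obtain ⟨u, hu, h⟩ := key k 0
  refine ⟨u, fun n => (hu n).trans (octScale_le_one _ _), fun n => ?_⟩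
  induction n with
  | zero =>
    intro hk
    have := h 0 le_rfl (by omega)
    simpa [octPush, octScale] using this
  | succ n ih =>
    intro hk
    have := h (n + 1) (by omega) (by omega)
    rw [octPush, ih (by omega), this]
    exact mul_div_cancel_right₀ _ (octScale_pos hy (n + 1)).ne'

lemma continuous_octPush {X : Type*} [TopologicalSpace X] {u : X → ℕ → ℝ} (hc : Continuous u)
    (hu : ∀ x n, |u x n| ≤ 1) (n : ℕ) : Continuous (fun x => octPush (u x) n) := by
  have hcn : ∀ n, Continuous fun x => u x n := fun n => (continuous_apply n).comp hc
  induction n with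
  | zero => exact (hcn 0).mul (continuous_octWidth.comp (hcn 1))
  | succ n ih =>
    refine Continuous.div ((hcn _).mul (continuous_octWidth.comp (hcn _)))
      (continuous_octHeight.comp ih) fun x => ?_
    have := octHeight_ge (abs_octPush_le_one (hu x) n)
    change octHeight (octPush (u x) n) ≠ 0
    linarith

/-- The coordinates of a point with positive index, rescaled to `[-1,1]`. -/
def symTail (x : HilbertCube) (n : ℕ) : ℝ := 2 * (x (n + 1) : ℝ) - 1

lemma abs_symTail_le (x : HilbertCube) (n : ℕ) : |symTail x n| ≤ 1 := by
  have h := (x (n + 1)).2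
  exact abs_le.2 ⟨by unfold symTail; linarith [h.1], by unfold symTail; linarith [h.2]⟩

lemma continuous_symTail : Continuous symTail :=
  continuous_pi fun n => ((continuous_const.mul
    (continuous_subtype_val.comp (continuous_apply (n + 1)))).sub continuous_const)

/-- A homeomorphism of the Hilbert cube that preserves the zeroth coordinate and moves points
whose coordinates are far from the centre off the faces of the cube. -/
lemma exists_homeomorph_push : ∃ h : HilbertCube ≃ₜ HilbertCube, (∀ x, h x 0 = x 0) ∧
    ∀ x n, 1 / 2 < |2 * (x (n + 2) : ℝ) - 1| → (h x (n + 1) : ℝ) ∈ Ioo (0:ℝ) 1 := by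
  let H : HilbertCube → HilbertCube := fun x n => Nat.casesOn n (x 0) fun n =>
    ⟨(octPush (symTail x) n + 1) / 2, by
      have := abs_le.1 (abs_octPush_le_one (abs_symTail_le x) n)
      constructor <;> linarith⟩
  have hHs : ∀ x n, (H x (n + 1) : ℝ) = (octPush (symTail x) n + 1) / 2 := fun _ _ => rfl
  have hc : Continuous H := by
    refine continuous_pi fun n => ?_
    cases n with
    | zero => exact continuous_apply 0
    | succ n =>
      exact Continuous.subtype_mk
        (((continuous_octPush continuous_symTail abs_symTail_le n).add continuous_const).div_const
          2) _
  have hinj : Function.Injective H := by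
    intro x y hxy
    have h0 : x 0 = y 0 := congrFun hxy 0
    have h1 : symTail x = symTail y := by
      refine octPush_injOn (abs_symTail_le x) (abs_symTail_le y) (funext fun n => ?_)
      have h2 : (H x (n + 1) : ℝ) = H y (n + 1) := by rw [hxy]
      rw [hHs, hHs] at h2
      linarith
    funext n
    cases n with
    | zero => exact h0
    | succ n =>
      have h2 := congrFun h1 n
      unfold symTail at h2
      exact Subtype.ext (by linarith)
  have hsurj : Function.Surjective H := by
    intro y
    let S : ℕ → Set HilbertCube := fun k => {x | x 0 = y 0} ∩
      ⋂ n, ⋂ _ : n < k, {x | H x (n + 1) = y (n + 1)}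
    have hcl : ∀ k, IsClosed (S k) := fun k =>
      (isClosed_eq (continuous_apply 0) continuous_const).inter
        (isClosed_iInter fun n => isClosed_iInter fun _ =>
          isClosed_eq ((continuous_apply (n + 1)).comp hc) continuous_const)
    have hne : ∀ k, (S k).Nonempty := by
      intro k
      obtain ⟨u, hu, h⟩ := exists_octPush_eq (abs_symTail_le y) k
      let x : HilbertCube := fun n => Nat.casesOn n (y 0) fun n =>
        ⟨(u n + 1) / 2, by
          have := abs_le.1 (hu n)
          constructor <;> linarith⟩
      have hx : symTail x = u := by
        funext n
        change 2 * ((u n + 1) / 2) - 1 = u n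
        ring
      refine ⟨x, rfl, ?_⟩
      simp only [mem_iInter]
      intro n hn
      refine Subtype.ext ?_
      rw [hHs, hx, h n hn]
      unfold symTail
      ring
    obtain ⟨x, hx⟩ := IsCompact.nonempty_iInter_of_sequence_nonempty_isCompact_isClosed S
      (fun k => inter_subset_inter_right _ (iInter_mono fun n =>
        iInter_mono' fun hn => ⟨by omega, subset_rfl⟩)) hne (hcl 0).isCompact hcl
    rw [mem_iInter] at hx
    refine ⟨x, funext fun n => ?_⟩
    cases n with
    | zero => exact (hx 0).1
    | succ n =>
      have := (hx (n + 1)).2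
      simp only [mem_iInter] at this
      exact this n (by omega)
  obtain ⟨h, hh⟩ := exists_homeomorph_of_bijective hc ⟨hinj, hsurj⟩
  refine ⟨h, fun x => by rw [hh]; rfl, fun x n hx => ?_⟩
  rw [hh, hHs]
  have h1 := abs_octPush_le (abs_symTail_le x) n
  have h2 : octWidth (symTail x (n + 1)) < 1 :=
    lt_of_le_of_lt (min_le_right _ _) (by
      change 5 / 4 - |2 * (x (n + 2) : ℝ) - 1| / 2 < 1
      linarith)
  have h3 := abs_lt.1 (h1.trans_lt h2)
  constructor <;> linarith

/-- The piecewise linear function rising from `0` to `1` between `a` and `b`. -/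
noncomputable def ramp (a b t : ℝ) : ℝ := max 0 (min 1 ((t - a) / (b - a)))

lemma ramp_nonneg (a b t : ℝ) : 0 ≤ ramp a b t := le_max_left _ _

lemma ramp_le_one (a b t : ℝ) : ramp a b t ≤ 1 := max_le zero_le_one (min_le_left _ _)

lemma continuous_ramp (a b : ℝ) : Continuous (ramp a b) := by unfold ramp; fun_prop

lemma ramp_eq_zero {a b t : ℝ} (hab : a < b) (h : t ≤ a) : ramp a b t = 0 :=
  max_eq_left ((min_le_right _ _).trans
    (div_nonpos_of_nonpos_of_nonneg (by linarith) (by linarith)))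

lemma ramp_eq_one {a b t : ℝ} (hab : a < b) (h : b ≤ t) : ramp a b t = 1 := by
  have h1 : 1 ≤ (t - a) / (b - a) := (one_le_div (by linarith)).2 (by linarith)
  rw [ramp, min_eq_left h1, max_eq_right zero_le_one]

lemma monotone_ramp {a b : ℝ} (hab : a < b) : Monotone (ramp a b) := by
  intro s t hst
  have : 0 < b - a := by linarith
  exact max_le_max le_rfl (min_le_min le_rfl (by gcongr))

/-- Replacing the zeroth coordinate by a function that is strictly increasing in it. -/
lemma exists_homeomorph_update {W : HilbertCube → Icc (0:ℝ) 1} (hW : Continuous W)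
    (hmono : ∀ x, StrictMono fun t => W (Function.update x 0 t))
    (h0 : ∀ x, x 0 = 0 → W x = 0) (h1 : ∀ x, x 0 = 1 → W x = 1) :
    ∃ h : HilbertCube ≃ₜ HilbertCube, ∀ x, h x = Function.update x 0 (W x) := by
  refine exists_homeomorph_of_bijective (continuous_id.update 0 hW) ⟨?_, ?_⟩
  · intro x y hxy
    have hy : y = Function.update x 0 (y 0) := by
      funext n
      rcases eq_or_ne n 0 with rfl | hn
      · simp
      · have := congrFun hxy n
        simpa [hn] using this.symm
    have hw : W (Function.update x 0 (x 0)) = W (Function.update x 0 (y 0)) := by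
      rw [← hy, Function.update_eq_self]
      simpa using congrFun hxy 0
    rw [hy, ← (hmono x).injective hw, Function.update_eq_self]
  · intro y
    obtain ⟨t, ht⟩ : y 0 ∈ range fun t => W (Function.update y 0 t) := by
      refine mem_range_of_exists_le_of_exists_ge
        (hW.comp (continuous_const.update 0 continuous_id)) ⟨0, ?_⟩ ⟨1, ?_⟩
      · rw [h0 _ (by simp)]
        exact (y 0).2.1
      · rw [h1 _ (by simp)]
        exact (y 0).2.2
    refine ⟨Function.update y 0 t, ?_⟩
    change Function.update (Function.update y 0 t) 0 (W (Function.update y 0 t)) = y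
    simp only at ht
    rw [ht]
    simp

/-- Products of increasing bijections of the unit interval. -/
lemma exists_homeomorph_coord (u : ℕ → Icc (0:ℝ) 1 → Icc (0:ℝ) 1) (hc : ∀ i, Continuous (u i))
    (hmono : ∀ i, StrictMono (u i)) (h0 : ∀ i, u i 0 = 0) (h1 : ∀ i, u i 1 = 1) :
    ∃ h : HilbertCube ≃ₜ HilbertCube, ∀ x i, h x i = u i (x i) := by
  obtain ⟨h, hh⟩ := exists_homeomorph_of_bijective (f := fun x : HilbertCube => fun i => u i (x i))
    (continuous_pi fun i => (hc i).comp (continuous_apply i))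
    ⟨fun x y hxy => funext fun i => (hmono i).injective (congrFun hxy i), fun y => by
      have : ∀ i, ∃ t, u i t = y i := fun i =>
        mem_range_of_exists_le_of_exists_ge (hc i) ⟨0, by rw [h0]; exact (y i).2.1⟩
          ⟨1, by rw [h1]; exact (y i).2.2⟩
      choose t ht using this
      exact ⟨t, funext ht⟩⟩
  exact ⟨h, fun x i => by rw [hh]⟩

/-- All coordinate projections of `K` have dense complement. -/
def HasThinProjections (K : Set HilbertCube) : Prop :=
  ∀ i : ℕ, ∀ a b : ℝ, 0 ≤ a → a < b → b ≤ 1 → ∃ c ∈ Ioo a b, ∀ x ∈ K, (x i : ℝ) ≠ c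

lemma HasThinProjections.exists_gap {K : Set HilbertCube} (h : HasThinProjections K)
    (hK : IsCompact K) (i : ℕ) {p q : ℝ} (hp : 0 ≤ p) (hpq : p < q) (hq : q ≤ 1) :
    ∃ a b, p ≤ a ∧ a < b ∧ b ≤ q ∧ ∀ x ∈ K, (x i : ℝ) < a ∨ b < (x i : ℝ) := by
  obtain ⟨c, hc, hcK⟩ := h i p q hp hpq hq
  have hT : IsClosed ((fun x : HilbertCube => (x i : ℝ)) '' K) :=
    (hK.image (by fun_prop)).isClosed
  have hmem : Ioo p q ∩ ((fun x : HilbertCube => (x i : ℝ)) '' K)ᶜ ∈ 𝓝 c :=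
    Filter.inter_mem (Ioo_mem_nhds hc.1 hc.2) (hT.isOpen_compl.mem_nhds (by
      rintro ⟨x, hx, hxc⟩
      exact hcK x hx hxc))
  obtain ⟨l, u, hlu, hsub⟩ := mem_nhds_iff_exists_Ioo_subset.1 hmem
  have h1 : (l + c) / 2 ∈ Ioo l u := by constructor <;> linarith [hlu.1, hlu.2]
  refine ⟨(l + c) / 2, c, (hsub h1).1.1.le, by linarith [hlu.1], hc.2.le, fun x hx => ?_⟩
  by_contra! hcon
  exact (hsub (⟨h1.1.trans_le hcon.1, hcon.2.trans_lt hlu.2⟩ : (x i : ℝ) ∈ Ioo l u)).2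
    (mem_image_of_mem _ hx)

/-- A sequence of gaps in the projections of `K` that is dense in every coordinate. -/
lemma HasThinProjections.exists_gap_seq {K : Set HilbertCube} (h : HasThinProjections K)
    (hK : IsCompact K) : ∃ (i : ℕ → ℕ) (a b : ℕ → ℝ), (∀ n, 0 ≤ a n) ∧ (∀ n, a n < b n) ∧
      (∀ n, b n ≤ 1) ∧ (∀ n, ∀ x ∈ K, (x (i n) : ℝ) < a n ∨ b n < (x (i n) : ℝ)) ∧
      ∀ j : ℕ, ∀ p q : ℝ, 0 ≤ p → p < q → q ≤ 1 → ∃ n, i n = j ∧ p ≤ a n ∧ b n ≤ q := by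
  have key : ∀ s : ℕ × ℚ × ℚ, ∃ a b : ℝ, 0 ≤ a ∧ a < b ∧ b ≤ 1 ∧
      (∀ x ∈ K, (x s.1 : ℝ) < a ∨ b < (x s.1 : ℝ)) ∧
      ((0:ℝ) ≤ s.2.1 → (s.2.1 : ℝ) < s.2.2 → (s.2.2 : ℝ) ≤ 1 →
        (s.2.1 : ℝ) ≤ a ∧ b ≤ (s.2.2 : ℝ)) := by
    rintro ⟨j, p, q⟩
    by_cases hs : (0:ℝ) ≤ p ∧ (p:ℝ) < q ∧ (q:ℝ) ≤ 1
    · obtain ⟨a, b, h1, h2, h3, h4⟩ := h.exists_gap hK j hs.1 hs.2.1 hs.2.2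
      exact ⟨a, b, hs.1.trans h1, h2, h3.trans hs.2.2, h4, fun _ _ _ => ⟨h1, h3⟩⟩
    · obtain ⟨a, b, h1, h2, h3, h4⟩ := h.exists_gap hK j le_rfl one_pos le_rfl
      exact ⟨a, b, h1, h2, h3, h4, fun g1 g2 g3 => (hs ⟨g1, g2, g3⟩).elim⟩
  choose a b h0 hab h1 hK' hs using key
  obtain ⟨e, he⟩ := exists_surjective_nat (ℕ × ℚ × ℚ)
  refine ⟨fun n => (e n).1, fun n => a (e n), fun n => b (e n), fun n => h0 _, fun n => hab _,
    fun n => h1 _, fun n => hK' _, fun j p q hp hpq hq => ?_⟩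
  obtain ⟨r, hr1, hr2⟩ := exists_rat_btwn hpq
  obtain ⟨s, hs1, hs2⟩ := exists_rat_btwn hr2
  obtain ⟨n, hn⟩ := he (j, r, s)
  obtain ⟨g1, g2⟩ := hs (j, r, s) (hp.trans hr1.le) hs1 (hs2.le.trans hq)
  refine ⟨n, ?_, ?_, ?_⟩
  · simp [hn]
  · simp only [hn]
    exact hr1.le.trans g1
  · simp only [hn]
    exact g2.trans hs2.le

/-- Recording the sides of a dense sequence of gaps separates points. -/
lemma gap_coding_injOn {K : Set HilbertCube} {i : ℕ → ℕ} {a b : ℕ → ℝ} (hab : ∀ n, a n < b n)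
    (hgap : ∀ n, ∀ x ∈ K, (x (i n) : ℝ) < a n ∨ b n < (x (i n) : ℝ))
    (hden : ∀ j : ℕ, ∀ p q : ℝ, 0 ≤ p → p < q → q ≤ 1 → ∃ n, i n = j ∧ p ≤ a n ∧ b n ≤ q) :
    InjOn (fun x n => decide (b n < (x (i n) : ℝ))) K := by
  have aux : ∀ x ∈ K, ∀ y ∈ K, ∀ j, (x j : ℝ) < y j →
      (fun n => decide (b n < (x (i n) : ℝ))) ≠ fun n => decide (b n < (y (i n) : ℝ)) := by
    intro x hx y hy j hlt heq
    obtain ⟨n, rfl, h1, h2⟩ := hden j _ _ (x j).2.1 hlt (y j).2.2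
    have hyn : b n < (y (i n) : ℝ) :=
      (hgap n y hy).resolve_left (by have := hab n; linarith)
    have := congrFun heq n
    rw [decide_eq_true hyn, decide_eq_true_iff] at this
    linarith [hab n]
  intro x hx y hy hxy
  by_contra hne
  obtain ⟨j, hj⟩ := Function.ne_iff.1 hne
  rcases lt_or_gt_of_ne (fun e => hj (Subtype.ext e) : (x j : ℝ) ≠ y j) with hlt | hlt
  · exact aux x hx y hy j hlt hxy
  · exact aux y hy x hx j hlt hxy.symm

/-- Sets with thin projections admit injective continuous binary codings. -/
lemma HasThinProjections.exists_coding {K : Set HilbertCube} (h : HasThinProjections K)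
    (hK : IsCompact K) : ∃ d : HilbertCube → ℕ → Bool, ContinuousOn d K ∧ InjOn d K := by
  obtain ⟨i, a, b, -, hab, -, hgap, hden⟩ := h.exists_gap_seq hK
  refine ⟨fun x n => decide (b n < (x (i n) : ℝ)), ?_, ?_⟩
  · refine continuousOn_pi.2 fun n => ?_
    intro x hx
    rcases hgap n x hx with hlt | hlt
    · have : ∀ᶠ y in 𝓝[K] x, decide (b n < (y (i n) : ℝ)) = false := by
        have ho : IsOpen {y : HilbertCube | (y (i n) : ℝ) < a n} :=
          isOpen_lt (by fun_prop) continuous_const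
        filter_upwards [mem_nhdsWithin_of_mem_nhds (ho.mem_nhds hlt)] with y hy
        simpa using (show (y (i n) : ℝ) < a n from hy).le.trans (hab n).le
      refine (continuousWithinAt_const (b := false)).congr_of_eventuallyEq this ?_
      simpa using hlt.le.trans (hab n).le
    · have : ∀ᶠ y in 𝓝[K] x, decide (b n < (y (i n) : ℝ)) = true := by
        have ho : IsOpen {y : HilbertCube | b n < (y (i n) : ℝ)} :=
          isOpen_lt continuous_const (by fun_prop)
        filter_upwards [mem_nhdsWithin_of_mem_nhds (ho.mem_nhds hlt)] with y hy
        simpa using hy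
      refine (continuousWithinAt_const (b := true)).congr_of_eventuallyEq this ?_
      simpa using hlt
  · exact gap_coding_injOn hab hgap hden

/-- A set with thin projections is moved onto a graph over the zeroth coordinate by changing
only that coordinate. -/
lemma HasThinProjections.exists_homeomorph_graph {K : Set HilbertCube} (h : HasThinProjections K)
    (hK : IsCompact K) {α β : ℝ} (hα : α ∈ Ioo (0:ℝ) 1) (hβ : β ∈ Ioo (0:ℝ) 1)
    (hαβ : ∀ x ∈ K, (x 0 : ℝ) ∈ Icc α β) :
    ∃ g : HilbertCube ≃ₜ HilbertCube, (∀ x, ∀ n ≠ 0, g x n = x n) ∧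
      InjOn (fun x => g x 0) K ∧ ∀ x ∈ K, (g x 0 : ℝ) ∈ Ioo (0:ℝ) 1 := by
  obtain ⟨i, a, b, ha, hab, hb, hgap, hden⟩ := h.exists_gap_seq hK
  let φ : ℕ → HilbertCube → ℝ := fun n x => ramp (a n) (b n) (x (i n))
  let τ : ℕ → HilbertCube → ℝ := fun n x => if i n = 0 then φ n x else
    φ n x * ramp 0 α (x 0) + (1 - φ n x) * ramp β 1 (x 0)
  have hφ0 : ∀ n x, 0 ≤ φ n x := fun n x => ramp_nonneg _ _ _
  have hφ1 : ∀ n x, φ n x ≤ 1 := fun n x => ramp_le_one _ _ _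
  have hφc : ∀ n, Continuous (φ n) := fun n => (continuous_ramp _ _).comp (by fun_prop)
  have hτ0 : ∀ n x, 0 ≤ τ n x := by
    intro n x
    by_cases hi : i n = 0
    · simpa [τ, hi] using hφ0 n x
    · simp only [τ, hi, if_false]
      have := mul_nonneg (hφ0 n x) (ramp_nonneg 0 α (x 0))
      have := mul_nonneg (sub_nonneg.2 (hφ1 n x)) (ramp_nonneg β 1 (x 0))
      linarith
  have hτ1 : ∀ n x, τ n x ≤ 1 := by
    intro n x
    by_cases hi : i n = 0
    · simpa [τ, hi] using hφ1 n x
    · simp only [τ, hi, if_false]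
      have := mul_le_of_le_one_right (hφ0 n x) (ramp_le_one 0 α (x 0))
      have := mul_le_of_le_one_right (sub_nonneg.2 (hφ1 n x)) (ramp_le_one β 1 (x 0))
      linarith
  have hτc : ∀ n, Continuous (τ n) := by
    intro n
    have h1 : Continuous fun x : HilbertCube => ramp 0 α (x 0) :=
      (continuous_ramp _ _).comp (by fun_prop)
    have h2 : Continuous fun x : HilbertCube => ramp β 1 (x 0) :=
      (continuous_ramp _ _).comp (by fun_prop)
    by_cases hi : i n = 0
    · simpa [τ, hi] using hφc n
    · simp only [τ, hi, if_false]
      exact ((hφc n).mul h1).add ((continuous_const.sub (hφc n)).mul h2)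
  have hτm : ∀ n x, Monotone fun t => τ n (Function.update x 0 t) := by
    intro n x s t hst
    have hst' : (s:ℝ) ≤ t := hst
    by_cases hi : i n = 0
    · simpa [τ, φ, hi] using monotone_ramp (hab n) hst'
    · simp only [τ, φ, hi, if_false, ne_eq, not_false_eq_true, Function.update_of_ne,
        Function.update_self]
      have h1 := mul_le_mul_of_nonneg_left (monotone_ramp hα.1 hst') (hφ0 n x)
      have h2 := mul_le_mul_of_nonneg_left (monotone_ramp hβ.2 hst') (sub_nonneg.2 (hφ1 n x))
      exact add_le_add h1 h2
  have hτz : ∀ n x, x 0 = 0 → τ n x = 0 := by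
    intro n x hx
    by_cases hi : i n = 0
    · simpa [τ, φ, hi, hx] using ramp_eq_zero (hab n) (ha n)
    · simp [τ, hi, hx, ramp_eq_zero hα.1 le_rfl, ramp_eq_zero hβ.2 hβ.1.le]
  have hτo : ∀ n x, x 0 = 1 → τ n x = 1 := by
    intro n x hx
    by_cases hi : i n = 0
    · simpa [τ, φ, hi, hx] using ramp_eq_one (hab n) (hb n)
    · simp [τ, hi, hx, ramp_eq_one hα.1 hα.2.le, ramp_eq_one hβ.2 le_rfl]
  have hτK : ∀ n, ∀ x ∈ K, τ n x = cond (decide (b n < (x (i n) : ℝ))) 1 0 := by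
    intro n x hx
    have hτφ : τ n x = φ n x := by
      by_cases hi : i n = 0
      · simp [τ, hi]
      · simp [τ, hi, ramp_eq_one hα.1 (hαβ x hx).1, ramp_eq_zero hβ.2 (hαβ x hx).2]
    rw [hτφ]
    rcases hgap n x hx with hlt | hlt
    · rw [decide_eq_false (by have := hab n; linarith)]
      exact ramp_eq_zero (hab n) hlt.le
    · rw [decide_eq_true hlt]
      exact ramp_eq_one (hab n) hlt.le
  have hgeo : HasSum (fun n : ℕ => 2 / 3 * (1 / 3 : ℝ) ^ n) 1 := by
    have := (hasSum_geometric_of_lt_one (r := (1 / 3 : ℝ)) (by norm_num) (by norm_num)).mul_left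
      (2 / 3)
    norm_num at this ⊢
    exact this
  have hpos : ∀ n : ℕ, (0:ℝ) < 2 / 3 * (1 / 3) ^ n := fun n => by positivity
  have hle : ∀ n x, 2 / 3 * (1 / 3 : ℝ) ^ n * τ n x ≤ 2 / 3 * (1 / 3) ^ n := fun n x =>
    mul_le_of_le_one_right (hpos n).le (hτ1 n x)
  have hge : ∀ n x, 0 ≤ 2 / 3 * (1 / 3 : ℝ) ^ n * τ n x := fun n x =>
    mul_nonneg (hpos n).le (hτ0 n x)
  have hsum : ∀ x, Summable fun n => 2 / 3 * (1 / 3 : ℝ) ^ n * τ n x := fun x =>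
    Summable.of_nonneg_of_le (fun n => hge n x) (fun n => hle n x) hgeo.summable
  let V : HilbertCube → ℝ := fun x => ∑' n, 2 / 3 * (1 / 3 : ℝ) ^ n * τ n x
  have hVc : Continuous V := by
    refine continuous_tsum (fun n => continuous_const.mul (hτc n)) hgeo.summable fun n x => ?_
    rw [Real.norm_eq_abs, abs_of_nonneg (hge n x)]
    exact hle n x
  have hV01 : ∀ x, V x ∈ Icc (0:ℝ) 1 := fun x =>
    ⟨tsum_nonneg fun n => hge n x, ((hsum x).tsum_le_tsum (fun n => hle n x)
      hgeo.summable).trans hgeo.tsum_eq.le⟩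
  let W : HilbertCube → Icc (0:ℝ) 1 := fun x => ⟨V x, hV01 x⟩
  have hWm : ∀ x, StrictMono fun t => W (Function.update x 0 t) := by
    intro x s t hst
    obtain ⟨n, hn, h1, h2⟩ := hden 0 s t s.2.1 hst t.2.2
    refine Summable.tsum_lt_tsum (i := n)
      (fun m => mul_le_mul_of_nonneg_left (hτm m x hst.le) (hpos m).le) ?_ (hsum _) (hsum _)
    refine mul_lt_mul_of_pos_left ?_ (hpos n)
    simp [τ, φ, hn, ramp_eq_zero (hab n) h1, ramp_eq_one (hab n) h2]
  have hW0 : ∀ x, x 0 = 0 → W x = 0 := fun x hx => Subtype.ext (by simp [W, V, hτz _ x hx])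
  have hW1 : ∀ x, x 0 = 1 → W x = 1 := fun x hx => Subtype.ext (by
    simp only [W, V, hτo _ x hx, mul_one]
    exact hgeo.tsum_eq)
  obtain ⟨g, hg⟩ := exists_homeomorph_update (hVc.subtype_mk hV01) hWm hW0 hW1
  have hg0 : ∀ x, g x 0 = W x := fun x => by rw [hg]; simp [W]
  refine ⟨g, fun x n hn => by rw [hg]; simp [hn], ?_, fun x hx => ?_⟩
  · intro x hx y hy hxy
    have hVK : ∀ x ∈ K, V x = 2 / 3 *
        Cardinal.cantorFunction (1 / 3) fun n => decide (b n < (x (i n) : ℝ)) := by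
      intro x hx
      rw [Cardinal.cantorFunction, ← tsum_mul_left]
      refine tsum_congr fun n => ?_
      rw [hτK n x hx, Cardinal.cantorFunctionAux]
      cases decide (b n < (x (i n) : ℝ)) <;> simp
    have hV : V x = V y := by
      simp only [hg0] at hxy
      exact congrArg Subtype.val hxy
    rw [hVK x hx, hVK y hy] at hV
    have hd := Cardinal.cantorFunction_injective (by norm_num) (by norm_num)
      (mul_left_cancel₀ (by norm_num) hV)
    exact gap_coding_injOn hab hgap hden hx hy hd
  · rw [hg0]
    have hlo := hWm x (show (0 : Icc (0:ℝ) 1) < x 0 from hα.1.trans_le (hαβ x hx).1)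
    have hhi := hWm x (show x 0 < (1 : Icc (0:ℝ) 1) from (hαβ x hx).2.trans_lt hβ.2)
    simp only [Function.update_eq_self] at hlo hhi
    rw [hW0 (Function.update x 0 0) (by simp)] at hlo
    rw [hW1 (Function.update x 0 1) (by simp)] at hhi
    exact ⟨hlo, hhi⟩

lemma HasThinProjections.isTame_of_zero {K : Set HilbertCube} (h : HasThinProjections K)
    (hK : IsCompact K) {α β : ℝ} (hα : α ∈ Ioo (0:ℝ) 1) (hβ : β ∈ Ioo (0:ℝ) 1)
    (hαβ : ∀ x ∈ K, (x 0 : ℝ) ∈ Icc α β) : IsTame K := by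
  obtain ⟨g, hg, hginj, hgI⟩ := h.exists_homeomorph_graph hK hα hβ hαβ
  choose a b ha hab hb hgap using fun i : ℕ => h.exists_gap hK i le_rfl one_pos le_rfl
  let v : ℕ → ℝ → ℝ := fun i t => if i = 0 then t else t / 8 + 7 / 8 * ramp (a i) (b i) t
  have hv0 : ∀ i, v i 0 = 0 := fun i => by
    by_cases hi : i = 0 <;> simp [v, hi, ramp_eq_zero (hab i) (ha i)]
  have hv1 : ∀ i, v i 1 = 1 := fun i => by
    by_cases hi : i = 0 <;> simp [v, hi, ramp_eq_one (hab i) (hb i)]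
    norm_num
  have hvm : ∀ i, StrictMono (v i) := by
    intro i s t hst
    by_cases hi : i = 0
    · simpa [v, hi] using hst
    · simp only [v, hi, if_false]
      linarith [monotone_ramp (hab i) hst.le]
  have hvc : ∀ i, Continuous (v i) := by
    intro i
    by_cases hi : i = 0
    · simp only [v, hi, if_true]
      exact continuous_id
    · simp only [v, hi, if_false]
      exact (continuous_id.div_const 8).add (continuous_const.mul (continuous_ramp _ _))
  have hv : ∀ i (t : Icc (0:ℝ) 1), v i t ∈ Icc (0:ℝ) 1 := fun i t =>
    ⟨(hv0 i).ge.trans ((hvm i).monotone t.2.1), ((hvm i).monotone t.2.2).trans (hv1 i).le⟩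
  obtain ⟨u, hu⟩ := exists_homeomorph_coord (fun i t => ⟨v i t, hv i t⟩)
    (fun i => ((hvc i).comp continuous_subtype_val).subtype_mk _)
    (fun i s t hst => hvm i hst) (fun i => Subtype.ext (hv0 i)) (fun i => Subtype.ext (hv1 i))
  obtain ⟨p, hp0, hp⟩ := exists_homeomorph_push
  have hz : ∀ x, p (u (g x)) 0 = g x 0 := fun x => by
    rw [hp0, hu]
    exact Subtype.ext (by simp [v])
  refine ⟨hK, (g.trans u).trans p, ?_, ?_⟩
  · rintro _ ⟨x, hx, rfl⟩ _ ⟨y, hy, rfl⟩ hxy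
    simp only [Homeomorph.trans_apply, hz] at hxy
    rw [hginj hx hy hxy]
  · rintro _ ⟨x, hx, rfl⟩ n
    simp only [Homeomorph.trans_apply]
    cases n with
    | zero =>
      rw [hz]
      exact hgI x hx
    | succ n =>
      refine hp _ _ ?_
      rw [hu, hg _ _ (by omega)]
      have h0 := (x (n + 2)).2.1
      have h1 := (x (n + 2)).2.2
      have hne : n + 2 ≠ 0 := by omega
      simp only [v, if_neg hne]
      rcases hgap (n + 2) x hx with hlt | hlt
      · rw [ramp_eq_zero (hab _) hlt.le]
        exact lt_abs.2 (Or.inr (by linarith))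
      · rw [ramp_eq_one (hab _) hlt.le]
        exact lt_abs.2 (Or.inl (by linarith))

lemma HasThinProjections.isTame {K : Set HilbertCube} (h : HasThinProjections K)
    (hK : IsCompact K) {i : ℕ} {α β : ℝ} (hα : α ∈ Ioo (0:ℝ) 1) (hβ : β ∈ Ioo (0:ℝ) 1)
    (hαβ : ∀ x ∈ K, (x i : ℝ) ∈ Icc α β) : IsTame K := by
  obtain ⟨s, hs⟩ := exists_homeomorph_swap 0 i
  refine IsTame.of_image s (isTame_of_zero (fun j a b ha hab hb => ?_) (hK.image s.continuous)
    hα hβ ?_)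
  · obtain ⟨c, hc, hcK⟩ := h (Equiv.swap 0 i j) a b ha hab hb
    refine ⟨c, hc, ?_⟩
    rintro _ ⟨x, hx, rfl⟩
    rw [hs]
    exact hcK x hx
  · rintro _ ⟨x, hx, rfl⟩
    rw [hs, Equiv.swap_apply_left]
    exact hαβ x hx

lemma HasThinProjections.mono {K L : Set HilbertCube} (h : HasThinProjections L) (hKL : K ⊆ L) :
    HasThinProjections K := fun i a b ha hab hb =>
  let ⟨c, hc, hcL⟩ := h i a b ha hab hb
  ⟨c, hc, fun x hx => hcL x (hKL hx)⟩

lemma isMeagre_of_countable {X : Type*} [TopologicalSpace X] [T1Space X]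
    (hX : ∀ x : X, interior {x} = ∅) {s : Set X} (hs : s.Countable) : IsMeagre s := by
  rw [← biUnion_of_singleton s]
  exact isMeagre_biUnion hs fun x _ =>
    (isClosed_singleton.isNowhereDense_iff.2 (hX x)).isMeagre

lemma interior_singleton_cantor (x : ℕ → Bool) : interior {x} = ∅ := by
  rw [← not_nonempty_iff_eq_empty]
  rintro ⟨y, hy⟩
  obtain rfl : y = x := mem_singleton_iff.1 (interior_subset hy)
  have ht : Filter.Tendsto (fun n => Function.update y n (!y n)) Filter.atTop (𝓝 y) := by
    refine tendsto_pi_nhds.2 fun k => tendsto_const_nhds.congr' ?_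
    filter_upwards [Filter.eventually_gt_atTop k] with n hn
    rw [Function.update_of_ne hn.ne]
  obtain ⟨n, hn⟩ := (ht.eventually (mem_interior_iff_mem_nhds.1 hy)).exists
  have := congrFun (mem_singleton_iff.1 hn) n
  simp at this

/-- Inside every continuous binary family of points one finds one with thin projections. -/
lemma exists_thin_subfamily {f : (ℕ → Bool) → HilbertCube} (hf : Continuous f) :
    ∃ e : (ℕ → Bool) → (ℕ → Bool), Continuous e ∧ Function.Injective e ∧
      HasThinProjections (range (f ∘ e)) := by
  let F : ℕ → ℝ → Set (ℕ → Bool) := fun i t => {c | (f c i : ℝ) = t}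
  have hFc : ∀ i t, IsClosed (F i t) := fun i t =>
    isClosed_eq (by fun_prop) continuous_const
  have hT : ∀ i, {t | (interior (F i t)).Nonempty}.Countable := by
    intro i
    refine PairwiseDisjoint.countable_of_nonempty_interior (s := F i) ?_ fun t ht => ht
    intro s _ t _ hst
    exact disjoint_left.2 fun c hs ht => hst (hs.symm.trans ht)
  have hex : ∀ r : ℕ × ℚ × ℚ, ∃ t : ℝ, interior (F r.1 t) = ∅ ∧
      ((r.2.1 : ℝ) < r.2.2 → t ∈ Ioo (r.2.1 : ℝ) r.2.2) := by
    rintro ⟨i, p, q⟩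
    by_cases hpq : (p:ℝ) < q
    · obtain ⟨t, ht, h⟩ := ((hT i).dense_compl ℝ).exists_between hpq
      exact ⟨t, not_nonempty_iff_eq_empty.1 ht, fun _ => h⟩
    · obtain ⟨t, ht⟩ := ((hT i).dense_compl ℝ).nonempty
      exact ⟨t, not_nonempty_iff_eq_empty.1 ht, fun h => (hpq h).elim⟩
  choose t ht hpq using hex
  let G : Set (ℕ → Bool) := (⋃ r, F r.1 (t r))ᶜ
  have hM : IsMeagre (⋃ r, F r.1 (t r)) := isMeagre_iUnion fun r =>
    ((hFc _ _).isNowhereDense_iff.2 (ht r)).isMeagre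
  have hG : ¬ G.Countable := by
    intro hc
    refine not_isMeagre_of_isOpen (X := ℕ → Bool) isOpen_univ univ_nonempty ?_
    rw [← union_compl_self (⋃ r, F r.1 (t r))]
    exact hM.union (isMeagre_of_countable interior_singleton_cantor hc)
  have hGm : MeasurableSet G := (MeasurableSet.iUnion fun r => (hFc _ _).measurableSet).compl
  have hP : PolishSpace (ℕ → Bool) := ⟨⟩
  obtain ⟨T, hT1, hT2, hGc, -⟩ := hGm.isClopenable
  obtain ⟨e, heG, hec, hei⟩ := @IsClosed.exists_nat_bool_injection_of_not_countable _ T hT2 G hGc hG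
  refine ⟨e, continuous_le_rng hT1 hec, hei, fun i a b ha hab hb => ?_⟩
  obtain ⟨r, hr1, hr2⟩ := exists_rat_btwn hab
  obtain ⟨s, hs1, hs2⟩ := exists_rat_btwn hr2
  have h1 := hpq (i, r, s) hs1
  refine ⟨t (i, r, s), ⟨hr1.trans h1.1, h1.2.trans hs2⟩, ?_⟩
  rintro _ ⟨c, rfl⟩ hc
  exact heG (mem_range_self c) (mem_iUnion.2 ⟨(i, r, s), hc⟩)

lemma exists_mem_Icc_of_mem_Ioo {t : ℝ} (ht : t ∈ Ioo (0:ℝ) 1) :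
    ∃ m : ℕ, t ∈ Icc (1 / ((m:ℝ) + 2)) (1 - 1 / ((m:ℝ) + 2)) := by
  obtain ⟨m, hm⟩ := exists_nat_one_div_lt (lt_min ht.1 (sub_pos.2 ht.2))
  have h1 : 1 / ((m:ℝ) + 2) ≤ 1 / (m + 1) := by gcongr; norm_num
  have h2 := hm.le.trans (min_le_left _ _)
  have h3 := hm.le.trans (min_le_right _ _)
  exact ⟨m, h1.trans h2, by linarith⟩

lemma one_div_add_two_mem (m : ℕ) : 1 / ((m:ℝ) + 2) ∈ Ioo (0:ℝ) 1 :=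
  ⟨by positivity, (div_lt_one (by positivity)).2 (by linarith [(Nat.cast_nonneg m : (0:ℝ) ≤ m)])⟩

lemma one_sub_one_div_add_two_mem (m : ℕ) : 1 - 1 / ((m:ℝ) + 2) ∈ Ioo (0:ℝ) 1 := by
  have := one_div_add_two_mem m
  constructor <;> linarith [this.1, this.2]

lemma exists_tame_subfamily_of_coord {B : Set HilbertCube} (hB : IsClosed B) {i : ℕ}
    (hu : ¬ (B ∩ {x | (x i : ℝ) ∈ Ioo (0:ℝ) 1}).Countable) :
    ∃ f : (ℕ → Bool) → HilbertCube, Continuous f ∧ Function.Injective f ∧ range f ⊆ B ∧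
      IsTame (range f) := by
  obtain ⟨m, hm⟩ : ∃ m : ℕ, ¬ (B ∩ {x | (x i : ℝ) ∈
      Icc (1 / ((m:ℝ) + 2)) (1 - 1 / ((m:ℝ) + 2))}).Countable := by
    by_contra! hcon
    refine hu ((countable_iUnion hcon).mono ?_)
    rintro x ⟨hxB, hx⟩
    obtain ⟨m, hm⟩ := exists_mem_Icc_of_mem_Ioo hx
    exact mem_iUnion.2 ⟨m, hxB, hm⟩
  have hc : Continuous fun x : HilbertCube => (x i : ℝ) := by fun_prop
  obtain ⟨f, hfr, hf, hfi⟩ :=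
    (hB.inter (isClosed_Icc.preimage hc)).exists_nat_bool_injection_of_not_countable hm
  obtain ⟨e, hec, hei, hth⟩ := exists_thin_subfamily hf
  have hsub := (range_comp_subset_range e f).trans hfr
  refine ⟨f ∘ e, hf.comp hec, hfi.comp hei, hsub.trans inter_subset_left,
    hth.isTame (isCompact_range (hf.comp hec)) (one_div_add_two_mem m)
      (one_sub_one_div_add_two_mem m) fun x hx => (hsub hx).2⟩

lemma half_lt_abs_of_notMem_Ioo {t : Icc (0:ℝ) 1} (ht : (t : ℝ) ∉ Ioo (0:ℝ) 1) :
    1 / 2 < |2 * (t : ℝ) - 1| := by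
  rcases t.2.1.eq_or_lt with h | h
  · rw [← h]
    norm_num
  · rw [le_antisymm t.2.2 (not_lt.1 fun h' => ht ⟨h, h'⟩)]
    norm_num

/-- Every uncountable closed subset of the Hilbert cube contains a tame Cantor set. -/
lemma exists_tame_subfamily {B : Set HilbertCube} (hB : IsClosed B) (hu : ¬ B.Countable) :
    ∃ f : (ℕ → Bool) → HilbertCube, Continuous f ∧ Function.Injective f ∧ range f ⊆ B ∧
      IsTame (range f) := by
  by_cases hex : ∃ i : ℕ, ¬ (B ∩ {x | (x i : ℝ) ∈ Ioo (0:ℝ) 1}).Countable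
  · obtain ⟨i, hi⟩ := hex
    exact exists_tame_subfamily_of_coord hB hi
  push Not at hex
  obtain ⟨p, -, hp⟩ := exists_homeomorph_push
  obtain ⟨f, hf, hfi, hfr, hft⟩ := exists_tame_subfamily_of_coord
    (p.isClosedMap B hB) (i := 1) (by
      intro hc
      refine hu (((countable_iUnion hex).union (hc.preimage p.injective)).mono fun x hx => ?_)
      by_cases hx2 : (x 2 : ℝ) ∈ Ioo (0:ℝ) 1
      · exact Or.inl (mem_iUnion.2 ⟨2, hx, hx2⟩)
      · exact Or.inr ⟨mem_image_of_mem p hx, hp x 0 (half_lt_abs_of_notMem_Ioo hx2)⟩)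
  refine ⟨p.symm ∘ f, p.symm.continuous.comp hf, p.symm.injective.comp hfi, ?_, ?_⟩
  · rintro _ ⟨c, rfl⟩
    obtain ⟨x, hx, hxc⟩ := hfr (mem_range_self c)
    rw [Function.comp_apply, ← hxc, Homeomorph.symm_apply_apply]
    exact hx
  · refine IsTame.of_image p ?_
    rw [range_comp, p.image_symm, image_preimage_eq _ p.surjective]
    exact hft

lemma isCantorSet_range {f : (ℕ → Bool) → HilbertCube} (hf : Continuous f)
    (hfi : Function.Injective f) : IsCantorSet (range f) :=
  ⟨(hf.isClosedEmbedding hfi).isEmbedding.toHomeomorph.symm⟩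

lemma IsCantorSet.isClosed {B : Set HilbertCube} (hB : IsCantorSet B) : IsClosed B := by
  obtain ⟨e⟩ := hB
  have : CompactSpace B := e.symm.compactSpace
  exact (isCompact_iff_compactSpace.2 this).isClosed

lemma not_countable_univ_cantor : ¬ (univ : Set (ℕ → Bool)).Countable := fun h =>
  not_isMeagre_of_isOpen (X := ℕ → Bool) isOpen_univ univ_nonempty
    (isMeagre_of_countable interior_singleton_cantor h)

lemma IsCantorSet.not_countable {B : Set HilbertCube} (hB : IsCantorSet B) : ¬ B.Countable := by
  obtain ⟨e⟩ := hB
  intro h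
  have h1 : Countable B := h.to_subtype
  have h2 : Countable (ℕ → Bool) := e.symm.injective.countable
  exact not_countable_univ_cantor countable_univ

/-- Tame Cantor sets are minimal. -/
lemma IsTame.isMinimalCantorSet {E : Set HilbertCube} (hE : IsTame E) (hC : IsCantorSet E) :
    IsMinimalCantorSet E := by
  refine ⟨hC, fun B hB => ?_⟩
  obtain ⟨φ⟩ := hC
  obtain ⟨f, hf, hfi, hfr, hft⟩ := exists_tame_subfamily hB.isClosed hB.not_countable
  classical
  let g : HilbertCube → HilbertCube := fun x => if h : x ∈ E then f (φ ⟨x, h⟩) else x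
  have hg : E.domRestrict g = f ∘ φ := by
    funext x
    exact dif_pos x.2
  have hgx : ∀ x : E, g x = f (φ x) := congrFun hg
  obtain ⟨h, hh⟩ := hE.exists_extension hft (f := g)
    (continuousOn_iff_continuous_domRestrict.2 (hg ▸ hf.comp φ.continuous))
    (fun x hx y hy hxy => by
      have h1 := hgx ⟨x, hx⟩
      have h2 := hgx ⟨y, hy⟩
      simp only at h1 h2
      rw [h1, h2] at hxy
      exact congrArg Subtype.val (φ.injective (hfi hxy)))
    (fun x hx => (hgx ⟨x, hx⟩).symm ▸ mem_range_self _)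
  refine ⟨h, ?_⟩
  rintro _ ⟨x, hx, rfl⟩
  rw [hh x hx]
  exact hfr ((hgx ⟨x, hx⟩).symm ▸ mem_range_self _)

lemma IsMinimalCantorSet.image {A : Set HilbertCube} (hA : IsMinimalCantorSet A)
    (g : HilbertCube ≃ₜ HilbertCube) : IsMinimalCantorSet (g '' A) := by
  obtain ⟨⟨e⟩, hmin⟩ := hA
  refine ⟨⟨(g.image A).symm.trans e⟩, fun B hB => ?_⟩
  obtain ⟨h, hh⟩ := hmin B hB
  refine ⟨g.symm.trans h, ?_⟩
  rw [image_image]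
  simpa using hh

/-- Tame sets with a binary coding are contained in minimal Cantor sets. -/
lemma IsTame.exists_minimal_superset {K : Set HilbertCube} (hK : IsTame K)
    {d : HilbertCube → ℕ → Bool} (hd : ContinuousOn d K) (hdi : InjOn d K) :
    ∃ C ∈ CantorFamily, K ⊆ C := by
  have hu : ¬ (univ : Set HilbertCube).Countable := fun h =>
    not_isMeagre_of_isOpen (X := HilbertCube) isOpen_univ univ_nonempty
      (isMeagre_of_countable (fun x => interior_singleton x) h)
  obtain ⟨f, hf, hfi, -, hft⟩ := exists_tame_subfamily isClosed_univ hu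
  obtain ⟨h, hh⟩ := hK.exists_extension hft (f := f ∘ d) (hf.comp_continuousOn hd)
    (fun x hx y hy hxy => hdi hx hy (hfi hxy)) (fun x _ => mem_range_self _)
  refine ⟨h.symm '' range f, (hft.isMinimalCantorSet (isCantorSet_range hf hfi)).image h.symm,
    fun x hx => ⟨h x, ?_, h.symm_apply_apply x⟩⟩
  rw [hh x hx]
  exact mem_range_self _

/-- The parametrization of the Hilbert cube by binary expansions of its coordinates. -/
noncomputable def cubeOfBits (z : ℕ → Bool) : HilbertCube := fun i =>
  ⟨Real.ofDigits fun j => finTwoEquiv.symm (z (Nat.pair i j)),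
    Real.ofDigits_nonneg _, Real.ofDigits_le_one _⟩

lemma continuous_cubeOfBits : Continuous cubeOfBits := by
  refine continuous_pi fun i => Continuous.subtype_mk (Real.continuous_ofDigits.comp ?_) _
  exact continuous_pi fun j => continuous_of_discreteTopology.comp (continuous_apply _)

/-- The images of cylinders under `cubeOfBits` contain nonempty open sets. -/
lemma exists_open_subset_cubeOfBits (t : ℕ → Bool) (N : ℕ) :
    ∃ O : Set HilbertCube, IsOpen O ∧ O.Nonempty ∧
      ∀ u ∈ O, ∃ z : ℕ → Bool, (∀ p < N, z p = t p) ∧ cubeOfBits z = u := by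
  let β : ℕ → ℝ := fun i => ∑ j ∈ Finset.range N,
    Real.ofDigitsTerm (fun j => finTwoEquiv.symm (t (Nat.pair i j))) j
  have hglue : ∀ v : ℕ → Icc (0:ℝ) 1, ∃ z : ℕ → Bool, (∀ p < N, z p = t p) ∧
      ∀ i, (cubeOfBits z i : ℝ) = if i < N then β i + (2 ^ N : ℝ)⁻¹ * v i else v i := by
    intro v
    have hd : ∀ i, ∃ a : ℕ → Fin 2, Real.ofDigits a = v i := fun i =>
      let ⟨a, _, ha⟩ := Real.ofDigits_SurjOn (b := 2) one_lt_two (v i).2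
      ⟨a, ha⟩
    choose a ha using hd
    let w : ℕ → ℕ → Bool := fun i j => if i < N then
      (if j < N then t (Nat.pair i j) else finTwoEquiv (a i (j - N))) else finTwoEquiv (a i j)
    refine ⟨fun p => w p.unpair.1 p.unpair.2, fun p hp => ?_, fun i => ?_⟩
    · have h1 := (Nat.unpair_left_le p).trans_lt hp
      have h2 := (Nat.unpair_right_le p).trans_lt hp
      simp [w, h1, h2]
    · simp only [cubeOfBits, Nat.unpair_pair]
      by_cases hi : i < N
      · rw [Real.ofDigits_eq_sum_add_ofDigits _ N, if_pos hi]
        congr 1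
        · refine Finset.sum_congr rfl fun j hj => ?_
          simp [Real.ofDigitsTerm, w, hi, Finset.mem_range.1 hj]
        · have : (fun j => finTwoEquiv.symm (w i (j + N))) = a i := by
            funext j
            simp [w, hi]
          rw [this, ha]
          norm_num
      · have : (fun j => finTwoEquiv.symm (w i j)) = a i := by
          funext j
          simp [w, hi]
        rw [this, ha, if_neg hi]
  have hpow : (0:ℝ) < (2 ^ N : ℝ)⁻¹ := by positivity
  refine ⟨⋂ i ∈ Finset.range N, {u | (u i : ℝ) ∈ Ioo (β i) (β i + (2 ^ N : ℝ)⁻¹)},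
    isOpen_biInter_finset fun i _ => isOpen_Ioo.preimage
      (continuous_subtype_val.comp (continuous_apply i)), ?_, fun u hu => ?_⟩
  · obtain ⟨z, -, hz⟩ := hglue fun _ => midI
    refine ⟨cubeOfBits z, ?_⟩
    simp only [mem_iInter, mem_ofPred_eq, Finset.mem_range]
    intro i hi
    rw [hz, if_pos hi]
    change β i + (2 ^ N : ℝ)⁻¹ * (1 / 2) ∈ _
    constructor <;> linarith
  · simp only [mem_iInter, mem_ofPred_eq, Finset.mem_range] at hu
    have hv : ∀ i, ∃ v : Icc (0:ℝ) 1,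
        (u i : ℝ) = if i < N then β i + (2 ^ N : ℝ)⁻¹ * v else (v : ℝ) := by
      intro i
      by_cases hi : i < N
      · refine ⟨⟨(u i - β i) * 2 ^ N, ?_, ?_⟩, ?_⟩
        · exact mul_nonneg (by linarith [(hu i hi).1]) (by positivity)
        · have := mul_le_mul_of_nonneg_right
            (show (u i : ℝ) - β i ≤ (2 ^ N : ℝ)⁻¹ by linarith [(hu i hi).2])
            (show (0:ℝ) ≤ 2 ^ N by positivity)
          rwa [inv_mul_cancel₀ (by positivity)] at this
        · rw [if_pos hi]
          field_simp
          ring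
      · exact ⟨u i, by rw [if_neg hi]⟩
    choose v hv using hv
    obtain ⟨z, hzt, hz⟩ := hglue v
    exact ⟨z, hzt, funext fun i => Subtype.ext ((hz i).trans (hv i).symm)⟩

/-- A block of bits that forces membership in a dense open set, whatever precedes it. -/
lemma exists_forcing_block {U : Set HilbertCube} (hU : IsOpen U) (hd : Dense U) (L : ℕ) :
    ∃ L' > L, ∃ w : ℕ → Bool, ∀ z : ℕ → Bool, (∀ p ∈ Ico L L', z p = w p) → cubeOfBits z ∈ U := by
  classical
  have key : ∀ T : Finset (ℕ → Bool), ∃ L' > L, ∃ w : ℕ → Bool, ∀ z : ℕ → Bool,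
      (∃ s ∈ T, ∀ p < L, z p = s p) → (∀ p ∈ Ico L L', z p = w p) → cubeOfBits z ∈ U := by
    intro T
    induction T using Finset.induction_on with
    | empty => exact ⟨L + 1, by omega, fun _ => true, fun z hz => by simp at hz⟩
    | insert s T _ ih =>
      obtain ⟨L', hL, w, hw⟩ := ih
      obtain ⟨O, hO, hOne, hOz⟩ :=
        exists_open_subset_cubeOfBits (fun p => if p < L then s p else w p) L'
      obtain ⟨u, huO, huU⟩ := hd.inter_open_nonempty O hO hOne
      obtain ⟨z₀, hz₀, rfl⟩ := hOz u huO
      obtain ⟨_, ⟨y, n, rfl⟩, hzc, hcU⟩ :=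
        (PiNat.isTopologicalBasis_cylinders fun _ => Bool).exists_subset_of_mem_open
          (show z₀ ∈ cubeOfBits ⁻¹' U from huU) (hU.preimage continuous_cubeOfBits)
      refine ⟨max L' n, by omega, z₀, fun z hz hzz => ?_⟩
      obtain ⟨r, hr, hrz⟩ := hz
      rcases Finset.mem_insert.1 hr with rfl | hr
      · refine hcU fun p hp => ?_
        rw [← hzc p hp]
        by_cases hpL : p < L
        · rw [hrz p hpL, hz₀ p (by omega), if_pos hpL]
        · exact hzz p ⟨by omega, by omega⟩
      · refine hw z ⟨r, hr, hrz⟩ fun p hp => ?_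
        rw [hzz p ⟨hp.1, by have := hp.2; omega⟩, hz₀ p hp.2, if_neg (by have := hp.1; omega)]
  obtain ⟨L', hL, w, hw⟩ := key (Finset.univ.image fun (s : Fin L → Bool) p =>
    if h : p < L then s ⟨p, h⟩ else true)
  refine ⟨L', hL, w, fun z hz => hw z ⟨_, Finset.mem_image_of_mem _
    (Finset.mem_univ fun q : Fin L => z q), fun p hp => ?_⟩ hz⟩
  simp [hp]

lemma isMeagre_of_card_lt {A : Set HilbertCube} (hA : #A < nonIdeal (MeagerIdeal HilbertCube)) :
    IsMeagre A := by
  by_contra h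
  exact notMem_of_lt_csInf' hA ⟨A, h, rfl⟩

lemma not_isMeagre_univ_cube : ¬ IsMeagre (univ : Set HilbertCube) :=
  not_isMeagre_of_isOpen isOpen_univ univ_nonempty

lemma aleph0_le_nonIdeal_meager : ℵ₀ ≤ nonIdeal (MeagerIdeal HilbertCube) := by
  refine le_csInf ⟨_, Set.univ, not_isMeagre_univ_cube, rfl⟩ ?_
  rintro _ ⟨A, hA, rfl⟩
  by_contra! h
  exact hA (isMeagre_of_countable (fun x => interior_singleton x)
    (Cardinal.le_aleph0_iff_set_countable.1 h.le))

/-- The index of the block of the interval partition `i` that contains `p`. -/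
def blockIndex (i : ℕ → ℕ) (p : ℕ) : ℕ := Nat.findGreatest (fun k => i k ≤ p) p

lemma StrictMono.blockIndex_eq {i : ℕ → ℕ} (hi : StrictMono i) {p m : ℕ}
    (hp : p ∈ Ico (i m) (i (m + 1))) : blockIndex i p = m := by
  refine Nat.findGreatest_eq_iff.2 ⟨hi.le_apply.trans hp.1, fun _ => hp.1, fun k hk _ hkp => ?_⟩
  exact (hp.2.trans_le (hi.monotone hk)).not_ge hkp

/-- Few binary sequences are eventually different, in blocks, from a single sequence. -/
lemma exists_block_ne {Y : Type} (hY : #Y < nonIdeal (MeagerIdeal HilbertCube))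
    (ψ : Y → ℕ → Bool) : ∃ i : ℕ → ℕ, StrictMono i ∧ ∃ x : ℕ → Bool, ∀ y,
      ∀ᶠ m in Filter.atTop, ∃ p ∈ Ico (i m) (i (m + 1)), ψ y p ≠ x p := by
  have hM : IsMeagre (range fun y => cubeOfBits (ψ y)) :=
    isMeagre_of_card_lt (Cardinal.mk_range_le.trans_lt hY)
  obtain ⟨S, hSo, hSd, hSc, hS⟩ := mem_residual_iff.1 hM
  obtain ⟨V, hV⟩ := (hSc.insert Set.univ).exists_eq_range (insert_nonempty _ _)
  have hVm : ∀ n, V n ∈ insert Set.univ S := fun n => hV ▸ mem_range_self n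
  have hVo : ∀ n, IsOpen (V n) := fun n => (hVm n).elim (fun h => h ▸ isOpen_univ) (hSo _)
  have hVd : ∀ n, Dense (V n) := fun n => (hVm n).elim (fun h => h ▸ dense_univ) (hSd _)
  have hb : ∀ m L : ℕ, ∃ L' > L, ∃ w : ℕ → Bool, ∀ z : ℕ → Bool,
      (∀ p ∈ Ico L L', z p = w p) → ∀ n ≤ m, cubeOfBits z ∈ V n := by
    intro m L
    obtain ⟨L', hL, w, hw⟩ := exists_forcing_block (U := ⋂ n ∈ Iic m, V n)
      ((finite_Iic m).isOpen_biInter fun n _ => hVo n)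
      (dense_biInter_of_isOpen (fun n _ => hVo n) (to_countable _) fun n _ => hVd n) L
    exact ⟨L', hL, w, fun z hz n hn => mem_iInter₂.1 (hw z hz) n hn⟩
  choose next hnext w hw using hb
  let i : ℕ → ℕ := fun n => Nat.rec (motive := fun _ => ℕ) 0 next n
  have hi : StrictMono i := strictMono_nat_of_lt_succ fun n => hnext n (i n)
  refine ⟨i, hi, fun p => w (blockIndex i p) (i (blockIndex i p)) p, fun y => ?_⟩
  obtain ⟨k, hk⟩ : ∃ k, cubeOfBits (ψ y) ∉ V k := by
    by_contra! hall
    refine hS (mem_sInter.2 fun t ht => ?_) (mem_range_self y)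
    obtain ⟨n, rfl⟩ : t ∈ range V := hV ▸ mem_insert_of_mem _ ht
    exact hall n
  filter_upwards [Filter.eventually_ge_atTop k] with m hm
  by_contra! hcon
  refine hk (hw m (i m) (ψ y) (fun p hp => ?_) k hm)
  rw [hcon p hp, hi.blockIndex_eq hp]

/-- A translation of guesses of a function at infinitely many places into guesses of another
function at infinitely many places of a prescribed infinite set. -/
lemma exists_guess_transfer : ∃ Γ : (ℕ → ℕ) → ℕ → ℕ, ∀ B : Set ℕ, B.Infinite → ∀ c : ℕ → ℕ,
    ∃ g : ℕ → ℕ, ∀ φ : ℕ → ℕ, (∃ᶠ n in Filter.atTop, φ n = g n) →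
      ∃ᶠ b in Filter.atTop, b ∈ B ∧ Γ φ b = c b := by
  classical
  obtain ⟨dec, hdec⟩ := exists_surjective_nat (Finset ℕ × (ℕ →₀ ℕ))
  let S : (ℕ → ℕ) → ℕ → Finset ℕ := fun φ n =>
    if (dec (φ n)).1.card ≤ 2 ^ n then (dec (φ n)).1 else ∅
  have hS : ∀ φ n, (S φ n).card ≤ 2 ^ n := by
    intro φ n
    by_cases h : (dec (φ n)).1.card ≤ 2 ^ n <;> simp [S, h]
  refine ⟨fun φ b => if h : ∃ n, b ∈ S φ n then (dec (φ (Nat.find h))).2 b else 0,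
    fun B hB c => ?_⟩
  have hsub : ∀ n : ℕ, ∃ T : Finset ℕ, (T : Set ℕ) ⊆ B \ Iic n ∧ T.card = 2 ^ n := fun n =>
    (hB.sdiff (finite_Iic n)).exists_subset_card_eq _
  choose T hTB hTc using hsub
  choose g hg using fun n => hdec (T n, Finsupp.indicator (T n) fun b _ => c b)
  refine ⟨g, fun φ hφ => Filter.frequently_atTop.2 fun k => ?_⟩
  obtain ⟨n, hkn, hn⟩ := Filter.frequently_atTop.1 hφ k
  have hSn : S φ n = T n := by simp [S, hn, hg, hTc]
  obtain ⟨b, hbT, hb⟩ : ∃ b ∈ T n, b ∉ (Finset.range n).biUnion (S φ) := by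
    refine Finset.exists_mem_notMem_of_card_lt_card ?_
    rw [hTc]
    refine (Finset.card_biUnion_le.trans (Finset.sum_le_sum fun m _ => hS φ m)).trans_lt ?_
    exact Nat.geomSum_lt le_rfl fun m hm => Finset.mem_range.1 hm
  have hbB := hTB n hbT
  refine ⟨b, hkn.trans (not_le.1 hbB.2).le, hbB.1, ?_⟩
  have hex : ∃ m, b ∈ S φ m := ⟨n, hSn ▸ hbT⟩
  have hfind : Nat.find hex = n := by
    refine (Nat.find_eq_iff hex).2 ⟨hSn ▸ hbT, fun m hm hbm => hb ?_⟩
    exact Finset.mem_biUnion.2 ⟨m, Finset.mem_range.2 hm, hbm⟩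
  simp only [dif_pos hex, hfind, hn, hg, Finsupp.indicator_of_mem hbT]

/-- Bartoszyński's characterization: few functions are eventually different from a single one. -/
lemma exists_eventually_ne {Y : Type} (hY : #Y < nonIdeal (MeagerIdeal HilbertCube))
    (φ : Y → ℕ → ℕ) : ∃ g : ℕ → ℕ, ∀ y, ∀ᶠ n in Filter.atTop, φ y n ≠ g n := by
  classical
  obtain ⟨Γ, hΓ⟩ := exists_guess_transfer
  obtain ⟨dec, hdec⟩ := exists_surjective_nat (Finset ℕ)
  let d : Y → ℕ → ℕ := fun y n => ∑ k ∈ Finset.range (n + 1), (φ y k + 1)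
  have hd : ∀ y, StrictMono (d y) := fun y => strictMono_nat_of_lt_succ fun n => by
    simp only [d]
    rw [Finset.sum_range_succ _ (n + 1)]
    omega
  have hφd : ∀ y n, φ y n < d y n := fun y n => by
    simp only [d]
    rw [Finset.sum_range_succ]
    omega
  have hYY : #(Y × Y) < nonIdeal (MeagerIdeal HilbertCube) := by
    rw [← Cardinal.mul_def]
    exact Cardinal.mul_lt_of_lt aleph0_le_nonIdeal_meager hY hY
  obtain ⟨i, hi, x, hx⟩ := exists_block_ne hYY fun q p =>
    decide (p ∈ dec (Γ (φ q.2) (blockIndex (d q.1) p)))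
  by_cases hcase : ∃ y, {n | ∃ k, d y n ≤ i k ∧ i (k + 1) ≤ d y (n + 1)}.Infinite
  · obtain ⟨y₀, hy₀⟩ := hcase
    choose c hc using fun n => hdec ((Finset.range (d y₀ (n + 1))).filter fun p => x p = true)
    obtain ⟨g, hg⟩ := hΓ _ hy₀ c
    refine ⟨g, fun y => ?_⟩
    by_contra hcon
    rw [Filter.not_eventually] at hcon
    simp only [not_not] at hcon
    obtain ⟨M, hM⟩ := Filter.eventually_atTop.1 (hx (y₀, y))
    obtain ⟨b, hb, ⟨k, hk1, hk2⟩, hbc⟩ := Filter.frequently_atTop.1 (hg _ hcon) (i M + 1)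
    have hMk : M ≤ k := by
      by_contra! h
      have h1 := (hd y₀).le_apply (x := b)
      have h2 := hi.monotone h.le
      omega
    obtain ⟨p, hp, hpx⟩ := hM k hMk
    have hpb : p ∈ Ico (d y₀ b) (d y₀ (b + 1)) := ⟨hk1.trans hp.1, hp.2.trans_le hk2⟩
    refine hpx ?_
    simp only [(hd y₀).blockIndex_eq hpb, hbc, hc, Finset.mem_filter, Finset.mem_range, hpb.2,
      true_and, Bool.decide_eq_true]
  · push Not at hcase
    let N : ℕ → ℕ := fun t => i (t + 1)
    have hNm : Monotone N := fun s t hst => hi.monotone (by omega)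
    have hN : id ≤ N := fun t => (Nat.le_succ t).trans hi.le_apply
    refine ⟨fun n => N^[n] n, fun y => ?_⟩
    obtain ⟨n₀, hn₀⟩ : ∃ n₀, ∀ n ≥ n₀, d y (n + 1) ≤ N (d y n) := by
      obtain ⟨b, hb⟩ := (hcase y).bddAbove
      refine ⟨b + 1, fun n hn => ?_⟩
      by_contra! h
      have : n ≤ b := hb ⟨d y n, hi.le_apply, h.le⟩
      omega
    have hit : ∀ m, d y (n₀ + m) ≤ N^[m] (d y n₀) := by
      intro m
      induction m with
      | zero => exact le_rfl
      | succ m ih =>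
        rw [Function.iterate_succ_apply']
        exact (hn₀ (n₀ + m) (by omega)).trans (hNm ih)
    filter_upwards [Filter.eventually_ge_atTop (max n₀ (d y n₀))] with n hn
    refine ((hφd y n).trans_le ?_).ne
    obtain ⟨m, rfl⟩ := Nat.exists_eq_add_of_le ((le_max_left _ _).trans hn)
    refine (hit m).trans ((hNm.iterate m ((le_max_right _ _).trans hn)).trans ?_)
    rw [Function.iterate_add_apply]
    exact Function.id_le_iterate_of_id_le hN n₀ _

lemma mem_sigmaC0_mono {A B : Set HilbertCube} (hB : B ∈ sigmaC0) (h : A ⊆ B) : A ∈ sigmaC0 :=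
  let ⟨S, hS, hBS⟩ := hB
  ⟨S, hS, h.trans hBS⟩

lemma iUnion_mem_sigmaC0 {A : ℕ → Set HilbertCube} (hA : ∀ n, A n ∈ sigmaC0) :
    (⋃ n, A n) ∈ sigmaC0 := by
  choose S hS hAS using hA
  refine ⟨fun n => S n.unpair.1 n.unpair.2, fun n => hS _ _, iUnion_subset fun n x hx => ?_⟩
  obtain ⟨k, hk⟩ := mem_iUnion.1 (hAS n hx)
  refine mem_iUnion.2 ⟨Nat.pair n k, ?_⟩
  simpa using hk

lemma image_mem_sigmaC0 {A : Set HilbertCube} (hA : A ∈ sigmaC0) (h : HilbertCube ≃ₜ HilbertCube) :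
    h '' A ∈ sigmaC0 := by
  obtain ⟨S, hS, hAS⟩ := hA
  refine ⟨fun n => h '' S n, fun n => (hS n).image h, ?_⟩
  rw [← image_iUnion]
  exact image_mono hAS

/-- The open intervals read off from a sequence of natural numbers. -/
def guessedGap (g : ℕ → ℕ) (i a b : ℕ) : Set HilbertCube :=
  {x | (x i : ℝ) * (b + 1) - a ∈ Ioo (1 / ((g (Nat.pair i (Nat.pair a b)) : ℝ) + 2))
    (1 / ((g (Nat.pair i (Nat.pair a b)) : ℝ) + 1))}

lemma isOpen_guessedGap (g : ℕ → ℕ) (i a b : ℕ) : IsOpen (guessedGap g i a b) :=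
  isOpen_Ioo.preimage (f := fun x : HilbertCube => (x i : ℝ) * (b + 1) - a) (by fun_prop)

lemma hasThinProjections_of_guessedGap (g : ℕ → ℕ) (m : ℕ) :
    HasThinProjections {x | ∀ i a b, m ≤ Nat.pair i (Nat.pair a b) → x ∉ guessedGap g i a b} := by
  intro i p q hp hpq hq
  obtain ⟨b₀, hb₀⟩ := exists_nat_gt (2 / (q - p))
  obtain ⟨b, hbm, hbq⟩ : ∃ b : ℕ, m ≤ b ∧ 2 < (q - p) * (b + 1) := by
    refine ⟨max m b₀, le_max_left _ _, ?_⟩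
    have h1 : (b₀ : ℝ) ≤ (max m b₀ : ℕ) := by exact_mod_cast le_max_right _ _
    have h2 := (div_lt_iff₀ (sub_pos.2 hpq)).1 hb₀
    nlinarith
  let a : ℕ := ⌊p * (b + 1)⌋₊ + 1
  have hb0 : (0:ℝ) < b + 1 := by positivity
  have ha1 : p * (b + 1) < a := by
    have := Nat.lt_floor_add_one (p * ((b:ℝ) + 1))
    push_cast [a]
    exact this
  have ha2 : (a:ℝ) ≤ p * (b + 1) + 1 := by
    have := Nat.floor_le (mul_nonneg hp hb0.le)
    push_cast [a]
    linarith
  let G : ℝ := g (Nat.pair i (Nat.pair a b))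
  have hG : 0 ≤ G := Nat.cast_nonneg _
  have hlt : 1 / (G + 2) < 1 / (G + 1) := by gcongr; norm_num
  have hG1 : 1 / (G + 1) ≤ 1 := (div_le_one (by linarith)).2 (by linarith)
  have hG2 : 0 < 1 / (G + 2) := by positivity
  obtain ⟨s, hs1, hs2⟩ := exists_between hlt
  refine ⟨(a + s) / (b + 1), ⟨?_, ?_⟩, fun x hx hxc => ?_⟩
  · rw [lt_div_iff₀ hb0]
    linarith
  · rw [div_lt_iff₀ hb0]
    linarith
  · refine hx i a b (hbm.trans ((Nat.right_le_pair a b).trans (Nat.right_le_pair i _))) ?_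
    have : (x i : ℝ) * (b + 1) - a = s := by
      rw [hxc]
      field_simp
      ring
    unfold guessedGap
    rw [mem_ofPred_eq, this]
    exact ⟨hs1, hs2⟩

lemma mem_sigmaC0_of_card_lt_of_coord {A : Set HilbertCube}
    (hA : #A < nonIdeal (MeagerIdeal HilbertCube)) {i₀ : ℕ}
    (hi₀ : ∀ x ∈ A, (x i₀ : ℝ) ∈ Ioo (0:ℝ) 1) : A ∈ sigmaC0 := by
  obtain ⟨g, hg⟩ := exists_eventually_ne hA fun x n =>
    ⌊1 / ((x.1 n.unpair.1 : ℝ) * (n.unpair.2.unpair.2 + 1) - n.unpair.2.unpair.1)⌋₊ - 1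
  let K : ℕ → ℕ → Set HilbertCube := fun m k =>
    {x | ∀ i a b, m ≤ Nat.pair i (Nat.pair a b) → x ∉ guessedGap g i a b} ∩
      {x | (x i₀ : ℝ) ∈ Icc (1 / ((k:ℝ) + 2)) (1 - 1 / ((k:ℝ) + 2))}
  have hKc : ∀ m k, IsCompact (K m k) := by
    intro m k
    refine IsClosed.isCompact (IsClosed.inter ?_ (isClosed_Icc.preimage (by fun_prop)))
    simp only [ofPred_forall]
    exact isClosed_iInter fun i => isClosed_iInter fun a => isClosed_iInter fun b =>
      isClosed_iInter fun _ => (isOpen_guessedGap g i a b).isClosed_compl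
  have hKm : ∀ m k, K m k ∈ sigmaC0 := by
    intro m k
    have hth : HasThinProjections (K m k) :=
      (hasThinProjections_of_guessedGap g m).mono inter_subset_left
    obtain ⟨d, hd, hdi⟩ := hth.exists_coding (hKc m k)
    obtain ⟨C, hC, hKC⟩ := (hth.isTame (hKc m k) (one_div_add_two_mem k)
      (one_sub_one_div_add_two_mem k) fun x hx => hx.2).exists_minimal_superset hd hdi
    exact ⟨fun _ => C, fun _ => hC, hKC.trans (subset_iUnion (fun _ : ℕ => C) 0)⟩
  refine mem_sigmaC0_mono (iUnion_mem_sigmaC0 fun m => iUnion_mem_sigmaC0 fun k => hKm m k) ?_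
  intro x hx
  obtain ⟨m, hm⟩ := Filter.eventually_atTop.1 (hg ⟨x, hx⟩)
  obtain ⟨k, hk⟩ := exists_mem_Icc_of_mem_Ioo (hi₀ x hx)
  refine mem_iUnion.2 ⟨m, mem_iUnion.2 ⟨k, fun i a b hmn hgap => hm _ hmn ?_, hk⟩⟩
  obtain ⟨h1, h2⟩ := hgap
  simp only [Nat.unpair_pair]
  set G := g (Nat.pair i (Nat.pair a b))
  have hG : (0:ℝ) ≤ G := Nat.cast_nonneg _
  have h0 : 0 < (x i : ℝ) * (b + 1) - a := lt_trans (by positivity) h1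
  have hfl : ⌊1 / ((x i : ℝ) * (b + 1) - a)⌋₊ = G + 1 := by
    rw [Nat.floor_eq_iff (by positivity)]
    constructor
    · rw [le_div_iff₀ h0]
      rw [lt_div_iff₀ (by positivity)] at h2
      push_cast
      linarith
    · rw [div_lt_iff₀ h0]
      rw [div_lt_iff₀ (by positivity)] at h1
      push_cast
      linarith
  rw [hfl, Nat.add_sub_cancel]

/-- Sets of cardinality less than `non(M)` belong to `σC₀`. -/
lemma mem_sigmaC0_of_card_lt {A : Set HilbertCube}
    (hA : #A < nonIdeal (MeagerIdeal HilbertCube)) : A ∈ sigmaC0 := by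
  obtain ⟨p, -, hp⟩ := exists_homeomorph_push
  have hsub : ∀ B ⊆ A, #B < nonIdeal (MeagerIdeal HilbertCube) := fun B hB =>
    (Cardinal.mk_le_mk_of_subset hB).trans_lt hA
  have hin : A ∩ {x | (x 2 : ℝ) ∈ Ioo (0:ℝ) 1} ∈ sigmaC0 :=
    mem_sigmaC0_of_card_lt_of_coord (hsub _ inter_subset_left) fun x hx => hx.2
  have hout : p '' (A \ {x | (x 2 : ℝ) ∈ Ioo (0:ℝ) 1}) ∈ sigmaC0 := by
    refine mem_sigmaC0_of_card_lt_of_coord (i₀ := 1)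
      (Cardinal.mk_image_le.trans_lt (hsub _ sdiff_subset)) ?_
    rintro _ ⟨x, hx, rfl⟩
    exact hp x 0 (half_lt_abs_of_notMem_Ioo hx.2)
  have hout' := image_mem_sigmaC0 hout p.symm
  simp only [image_image, Homeomorph.symm_apply_apply, image_id'] at hout'
  refine mem_sigmaC0_mono (iUnion_mem_sigmaC0 (A := fun n =>
    if n = 0 then A ∩ {x | (x 2 : ℝ) ∈ Ioo (0:ℝ) 1} else
      A \ {x | (x 2 : ℝ) ∈ Ioo (0:ℝ) 1}) fun n => ?_) fun x hx => ?_
  · by_cases hn : n = 0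
    · simpa only [hn, if_true] using hin
    · simpa only [hn, if_false] using hout'
  · by_cases hx2 : (x 2 : ℝ) ∈ Ioo (0:ℝ) 1
    · exact mem_iUnion.2 ⟨0, hx, hx2⟩
    · exact mem_iUnion.2 ⟨1, hx, hx2⟩

/-- Minimal Cantor sets are meager. -/
lemma IsMinimalCantorSet.isMeagre {A : Set HilbertCube} (hA : IsMinimalCantorSet A) :
    IsMeagre A := by
  let f : (ℕ → Bool) → HilbertCube := fun z n => cond (z n) 1 0
  have hf : Continuous f := continuous_pi fun n =>
    (continuous_of_discreteTopology (f := fun b : Bool => cond b (1 : Icc (0:ℝ) 1) 0)).comp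
      (continuous_apply n)
  have hfi : Function.Injective f := fun y z hyz => funext fun n => by
    have := congrFun hyz n
    simp only [f] at this
    cases hy : y n <;> cases hz : z n <;> simp_all
  obtain ⟨h, hh⟩ := hA.2 _ (isCantorSet_range hf hfi)
  have hN : IsNowhereDense (range f) := by
    refine (isCompact_range hf).isClosed.isNowhereDense_iff.2 ?_
    rw [← not_nonempty_iff_eq_empty]
    rintro ⟨x, hx⟩
    have hc : Continuous fun t : Icc (0:ℝ) 1 => Function.update x 0 t :=
      continuous_const.update 0 continuous_id
    have hsub : (fun t => Function.update x 0 t) ⁻¹' interior (range f) ⊆ {0, 1} := by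
      intro t ht
      obtain ⟨z, hz⟩ := interior_subset ht
      have := congrFun hz 0
      simp only [Function.update_self, f] at this
      cases hz0 : z 0 <;> simp_all
    have hU : IsOpen ((fun t => Function.update x 0 t) ⁻¹' interior (range f)) :=
      isOpen_interior.preimage hc
    have hne : ((fun t => Function.update x 0 t) ⁻¹' interior (range f)).Nonempty :=
      ⟨x 0, by simpa using hx⟩
    exact not_isMeagre_of_isOpen hU hne
      ((isMeagre_of_countable (fun t => interior_singleton t) (by simp)).mono hsub)
  exact (hN.isMeagre.preimage_of_isOpenMap h.continuous h.isOpenMap).mono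
    (image_subset_iff.1 hh)

lemma isMeagre_of_mem_sigmaC0 {A : Set HilbertCube} (hA : A ∈ sigmaC0) : IsMeagre A := by
  obtain ⟨S, hS, hAS⟩ := hA
  exact (isMeagre_iUnion fun n => (hS n).isMeagre).mono hAS

/-- `non(σC₀) = non(M)`. -/
theorem non_sigmaC0_eq_non_meager :
    nonIdeal sigmaC0 = nonIdeal (MeagerIdeal HilbertCube) := by
  refine le_antisymm ?_ ?_
  · refine csInf_le_csInf' ⟨_, Set.univ, not_isMeagre_univ_cube, rfl⟩ ?_
    rintro _ ⟨A, hA, rfl⟩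
    exact ⟨A, fun h => hA (isMeagre_of_mem_sigmaC0 h), rfl⟩
  · refine le_csInf ⟨_, Set.univ, fun h => not_isMeagre_univ_cube (isMeagre_of_mem_sigmaC0 h),
      rfl⟩ ?_
    rintro _ ⟨A, hA, rfl⟩
    by_contra! h
    exact hA (mem_sigmaC0_of_card_lt h)
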